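/- arXiv:2203.03470 — 12 statements merged into one kernel-verified Lean document; each statement's English description precedes it below -/
import Mathlib

section
/- Let M ∈ 𝒦(C), x ∈ C \ M, and y ∈ P_M(x). Let z = (1−λ)x + λy for some λ ∈ (0,1) with dist(z, M) > 0, and set N := M ∪ {z}. Then for every ε with 0 < ε ≤ dist(z,M)/3 and every N' ∈ 𝒦(C) with H(N, N') < ε, one has P_N(x) = {z} and P_{N'}(x) ⊆ closedBall(z, ε). -/
open Metric Set

/-- The metric projection of `x` onto the set `M`. -/
def projSet {X : Type*} [NormedAddCommGroup X] (M : Set X) (x : X) : Set X :=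
  {y ∈ M | dist x y = Metric.infDist x M}

/-- Let `M ∈ 𝒦(C)`, `x ∈ C \ M`, `y ∈ P_M(x)`,
`z = (1−λ)x + λy` with `λ ∈ (0,1)` and `dist(z,M) > 0`, and `N = M ∪ {z}`.
Then for every `0 < ε ≤ dist(z,M)/3` and every `N' ∈ 𝒦(C)` with `H(N,N') < ε`,
we have `P_N(x) = {z}` and `P_{N'}(x) ⊆ closedBall(z, ε)`. -/
theorem proj_close_sets
    {X : Type*} [NormedAddCommGroup X] [NormedSpace ℝ X] [CompleteSpace X]
    (C : Set X) (hCne : C.Nonempty) (hCcl : IsClosed C)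
    (hCbd : Bornology.IsBounded C) (hCcv : Convex ℝ C)
    (M : Set X) (hMne : M.Nonempty) (hMcp : IsCompact M) (hMC : M ⊆ C)
    (x : X) (hx : x ∈ C \ M)
    (y : X) (hyM : y ∈ M) (hyP : dist x y = infDist x M)
    (lam : ℝ) (hlam : lam ∈ Set.Ioo (0 : ℝ) 1)
    (z : X) (hz : z = (1 - lam) • x + lam • y) (hzM : 0 < infDist z M)
    (N : Set X) (hN : N = M ∪ {z})
    (ε : ℝ) (hε0 : 0 < ε) (hε : ε ≤ infDist z M / 3)
    (N' : Set X) (hN'ne : N'.Nonempty) (hN'cp : IsCompact N') (hN'C : N' ⊆ C)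
    (hdist : hausdorffDist N N' < ε) :
    projSet N x = {z} ∧ projSet N' x ⊆ closedBall z ε := by
  obtain ⟨h0, h1⟩ := hlam
  have hxz : dist x z = lam * dist x y := by
    have : x - z = lam • (x - y) := by rw [hz]; module
    rw [dist_eq_norm, this, norm_smul, Real.norm_of_nonneg h0.le, dist_eq_norm]
  have hzy : dist z y = (1 - lam) * dist x y := by
    have : z - y = (1 - lam) • (x - y) := by rw [hz]; module
    rw [dist_eq_norm, this, norm_smul, Real.norm_of_nonneg (by linarith), dist_eq_norm]
  have hzi : infDist z M ≤ (1 - lam) * dist x y := hzy ▸ infDist_le_dist_of_mem hyM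
  have hm : ∀ m ∈ M, dist x y ≤ dist x m := fun m hmM => hyP ▸ infDist_le_dist_of_mem hmM
  have hlt : dist x z < dist x y := by rw [hxz]; nlinarith
  have hzN : z ∈ N := by rw [hN]; simp
  have hNne : N.Nonempty := ⟨z, hzN⟩
  have hNcp : IsCompact N := by rw [hN]; exact hMcp.union isCompact_singleton
  have hmin : ∀ n ∈ N, dist x z ≤ dist x n := by
    intro n hn
    rw [hN] at hn
    rcases hn with hn | hn
    · exact hlt.le.trans (hm n hn)
    · rw [mem_singleton_iff.1 hn]
  have hinf : infDist x N = dist x z :=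
    le_antisymm (infDist_le_dist_of_mem hzN) ((le_infDist hNne).2 hmin)
  have hfin : hausdorffEDist N N' ≠ ⊤ :=
    hausdorffEDist_ne_top_of_nonempty_of_bounded hNne hN'ne hNcp.isBounded hN'cp.isBounded
  refine ⟨?_, ?_⟩
  · ext p
    simp only [projSet, mem_ofPred_eq, mem_singleton_iff, hinf]
    constructor
    · rintro ⟨hp, hd⟩
      rw [hN] at hp
      rcases hp with hp | hp
      · have := hm p hp
        linarith
      · exact hp
    · rintro rfl
      exact ⟨hzN, rfl⟩
  · rintro p ⟨hp, hd⟩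
    obtain ⟨n, hn, hpn⟩ := exists_dist_lt_of_hausdorffDist_lt' hp hdist hfin
    obtain ⟨q, hq, hzq⟩ := exists_dist_lt_of_hausdorffDist_lt hzN hdist hfin
    rw [mem_closedBall]
    rw [hN] at hn
    rcases hn with hn | hn
    · exfalso
      have a1 := hm n hn
      have a2 : dist x p ≤ dist x q := hd ▸ infDist_le_dist_of_mem hq
      have a3 := dist_triangle x z q
      have a4 := dist_triangle x p n
      rw [dist_comm] at hpn
      first
        | linarith
        | (rw [dist_comm] at hpn; linarith)
    · rw [mem_singleton_iff.1 hn] at hpn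
      first
        | exact hpn.le
        | exact (dist_comm p z ▸ hpn.le)
end

section
/- Let X be a Banach space, C ⊆ X a nonempty, closed, bounded and convex set, and fix x ∈ C. Then the set {M ∈ 𝒦(C) : P_M(x) is not a singleton} is σ-porous in the metric space (𝒦(C), H). Equivalently, there is a set 𝓑 ⊆ 𝒦(C) whose complement in 𝒦(C) is σ-porous such that for every M ∈ 𝓑 the metric projection P_M(x) is a singleton. -/
open Metric Set TopologicalSpace

/-- A subset `E` of a metric space is porous if it is porous at each of its points:
there are `r₀ > 0` and `α > 0` such that for every `r ∈ (0, r₀)` there is a point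
`y ∈ B(x,r)` with `B(y, α r) ∩ E = ∅`. -/
def IsPorous {Y : Type*} [MetricSpace Y] (E : Set Y) : Prop :=
  ∀ x ∈ E, ∃ r₀ > (0 : ℝ), ∃ α > (0 : ℝ), ∀ r, 0 < r → r < r₀ →
    ∃ y ∈ Metric.ball x r, Metric.ball y (α * r) ∩ E = ∅

/-- A set is σ-porous if it is a countable union of porous sets. -/
def IsSigmaPorous {Y : Type*} [MetricSpace Y] (E : Set Y) : Prop :=
  ∃ f : ℕ → Set Y, (∀ n, IsPorous (f n)) ∧ E = ⋃ n, f n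

/-- Fix `x ∈ C`. In the hyperspace `𝒦(C)` of nonempty compact subsets of `C`
with the Pompeiu–Hausdorff metric, the collection of sets `M` whose metric projection
`P_M(x)` is not a singleton is σ-porous; equivalently, there is `𝓑 ⊆ 𝒦(C)` with σ-porous
complement such that `P_M(x)` is a singleton for every `M ∈ 𝓑`. -/
theorem sigmaPorous_not_unique_projection
    {X : Type*} [NormedAddCommGroup X] [NormedSpace ℝ X] [CompleteSpace X]
    (C : Set X) (hCne : C.Nonempty) (hCcl : IsClosed C)
    (hCbd : Bornology.IsBounded C) (hCcv : Convex ℝ C)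
    (x : X) (hx : x ∈ C) :
    IsSigmaPorous {M : {K : NonemptyCompacts X // (K : Set X) ⊆ C} |
        ¬ ∃ z : X, {y ∈ (M.1 : Set X) | dist x y = infDist x (M.1 : Set X)} = {z}} ∧
    ∃ B : Set {K : NonemptyCompacts X // (K : Set X) ⊆ C},
      IsSigmaPorous Bᶜ ∧
      ∀ M ∈ B, ∃ z : X, {y ∈ (M.1 : Set X) | dist x y = infDist x (M.1 : Set X)} = {z} := by
  have key : IsSigmaPorous {M : {K : NonemptyCompacts X // (K : Set X) ⊆ C} |
        ¬ ∃ z : X, {y ∈ (M.1 : Set X) | dist x y = infDist x (M.1 : Set X)} = {z}} := by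
    refine ⟨fun n => {M | ∃ y ∈ (M.1 : Set X), ∃ z ∈ (M.1 : Set X),
      dist x y = infDist x (M.1 : Set X) ∧ dist x z = infDist x (M.1 : Set X) ∧
      1 / ((n : ℝ) + 1) < dist y z}, ?_, ?_⟩
    · intro n M hM
      obtain ⟨y, hyM, z, hzM, hy, hz, hyz⟩ := hM
      have hn : (0 : ℝ) < 1 / ((n : ℝ) + 1) := by positivity
      have hd : 0 < infDist x (M.1 : Set X) := by
        rcases (infDist_nonneg (x := x) (s := (M.1 : Set X))).lt_or_eq with h | h
        · exact h
        · rw [← h] at hy hz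
          rw [← dist_eq_zero.1 hy, ← dist_eq_zero.1 hz, dist_self] at hyz
          linarith
      set d := infDist x (M.1 : Set X) with hdd
      refine ⟨min d (1 / ((n : ℝ) + 1)), lt_min hd hn, 1 / 4, by norm_num, ?_⟩
      intro r hr0 hr
      have hr1 := hr.trans_le (min_le_left _ _)
      have hr2 := hr.trans_le (min_le_right _ _)
      set s : ℝ := r / 2 / d with hs
      have hs0 : 0 < s := by positivity
      have hsd : s * d = r / 2 := by rw [hs]; field_simp
      have hs1 : s < 1 := by rw [hs, div_lt_one hd]; linarith
      set y' : X := AffineMap.lineMap y x s with hy'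
      have hy'C : y' ∈ C := hCcv.lineMap_mem (M.2 hyM) hx ⟨hs0.le, hs1.le⟩
      have h1 : dist y' y = r / 2 := by
        rw [hy', dist_lineMap_left, Real.norm_of_nonneg hs0.le, dist_comm y x, hy, hsd]
      have h2 : dist x y' = d - r / 2 := by
        rw [hy', dist_comm, dist_lineMap_right, Real.norm_of_nonneg (by linarith),
          dist_comm y x, hy, sub_mul, hsd, one_mul]
      let M' : {K : NonemptyCompacts X // (K : Set X) ⊆ C} :=
        ⟨⟨⟨insert y' (M.1 : Set X), M.1.isCompact.insert y'⟩, ⟨y', mem_insert _ _⟩⟩,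
          insert_subset hy'C M.2⟩
      have hM' : (M'.1 : Set X) = insert y' (M.1 : Set X) := rfl
      refine ⟨M', ?_, ?_⟩
      · rw [mem_ball, Subtype.dist_eq, NonemptyCompacts.dist_eq, hM']
        refine lt_of_le_of_lt (hausdorffDist_le_of_mem_dist (r := r / 2) (by linarith) ?_ ?_)
          (by linarith)
        · intro a ha
          rcases ha with rfl | ha
          · exact ⟨y, hyM, h1.le⟩
          · exact ⟨a, ha, by rw [dist_self]; linarith⟩
        · intro a ha
          exact ⟨a, mem_insert_of_mem _ ha, by rw [dist_self]; linarith⟩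
      · rw [eq_empty_iff_forall_notMem]
        rintro N ⟨hN, u, huN, v, hvN, hu, hv, huv⟩
        rw [mem_ball, Subtype.dist_eq, NonemptyCompacts.dist_eq] at hN
        have hfin : hausdorffEDist (N.1 : Set X) (M'.1 : Set X) ≠ ⊤ :=
          hausdorffEDist_ne_top_of_nonempty_of_bounded N.1.nonempty M'.1.nonempty
            N.1.isCompact.isBounded M'.1.isCompact.isBounded
        obtain ⟨w, hwN, hw⟩ := exists_dist_lt_of_hausdorffDist_lt'
          (show y' ∈ (M'.1 : Set X) from mem_insert _ _) hN hfin
        have hdN : infDist x (N.1 : Set X) < d - r / 2 + 1 / 4 * r := by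
          have := infDist_le_dist_of_mem (x := x) hwN
          have := dist_triangle x y' w
          have := dist_comm y' w
          linarith
        have near : ∀ u ∈ (N.1 : Set X), dist x u = infDist x (N.1 : Set X) →
            dist u y' < 1 / 4 * r := by
          intro u huN hu
          obtain ⟨m, hm, hum⟩ := exists_dist_lt_of_hausdorffDist_lt huN hN hfin
          rcases hm with rfl | hm
          · exact hum
          · exfalso
            have := infDist_le_dist_of_mem (x := x) hm
            have := dist_triangle x u m
            linarith
        have := near u huN hu
        have := near v hvN hv
        have := dist_triangle_right u v y'
        linarith
    · ext M
      simp only [mem_setOf_eq, mem_iUnion]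
      constructor
      · intro h
        obtain ⟨y, hyM, hy⟩ := M.1.isCompact.exists_infDist_eq_dist M.1.nonempty x
        have : ∃ z ∈ (M.1 : Set X), dist x z = infDist x (M.1 : Set X) ∧ z ≠ y := by
          by_contra! hc
          refine h ⟨y, ?_⟩
          ext z
          constructor
          · rintro ⟨h1, h2⟩
            exact hc z h1 h2
          · rintro rfl
            exact ⟨hyM, hy.symm⟩
        obtain ⟨z, hzM, hz, hne⟩ := this
        obtain ⟨n, hn⟩ := exists_nat_one_div_lt (dist_pos.2 hne.symm)
        exact ⟨n, y, hyM, z, hzM, hy.symm, hz, hn⟩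
      · rintro ⟨n, y, hyM, z, hzM, hy, hz, hyz⟩ ⟨w, hw⟩
        have e1 : y ∈ ({w} : Set X) := hw ▸ ⟨hyM, hy⟩
        have e2 : z ∈ ({w} : Set X) := hw ▸ ⟨hzM, hz⟩
        rw [mem_singleton_iff] at e1 e2
        rw [e1, e2, dist_self] at hyz
        have hn : (0 : ℝ) < 1 / ((n : ℝ) + 1) := by positivity
        linarith
  refine ⟨key, {M | ∃ z : X, {y ∈ (M.1 : Set X) | dist x y = infDist x (M.1 : Set X)} = {z}},
    ?_, fun M hM => hM⟩
  exact key
end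

section
/- Let C be a convex subset of a Banach space X, let (Y, ρ) be a metric space, z ∈ X, and δ, L₁, L₂ > 0. Let f : C → Y be a continuous map such that ρ(f(x), f(y)) ≤ L₁‖x−y‖ for all x, y ∈ B(z,δ) ∩ C and ρ(f(x̃), f(ỹ)) ≤ L₂‖x̃−ỹ‖ for all x̃, ỹ ∈ C \ B(z,δ). Then f is Lipschitz continuous on C with Lipschitz constant at most max{L₁, L₂}. -/
open Metric Set

/-- Let `C` be a convex subset of a Banach space `X`, `(Y, ρ)` a metric
space, `z ∈ X`, `δ, L₁, L₂ > 0`, and let `f : C → Y` be continuous, `L₁`-Lipschitz on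
`B(z,δ) ∩ C` and `L₂`-Lipschitz on `C \ B(z,δ)`. Then `f` is Lipschitz on `C` with
constant at most `max L₁ L₂`. -/
theorem lipschitz_on_ball_and_complement
    {X : Type*} [NormedAddCommGroup X] [NormedSpace ℝ X] [CompleteSpace X]
    {Y : Type*} [MetricSpace Y]
    (C : Set X) (hCcv : Convex ℝ C)
    (z : X) (δ L₁ L₂ : ℝ) (hδ : 0 < δ) (hL₁ : 0 < L₁) (hL₂ : 0 < L₂)
    (f : X → Y) (hf : ContinuousOn f C)
    (h₁ : ∀ x ∈ ball z δ ∩ C, ∀ y ∈ ball z δ ∩ C, dist (f x) (f y) ≤ L₁ * ‖x - y‖)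
    (h₂ : ∀ x ∈ C \ ball z δ, ∀ y ∈ C \ ball z δ, dist (f x) (f y) ≤ L₂ * ‖x - y‖) :
    ∀ x ∈ C, ∀ y ∈ C, dist (f x) (f y) ≤ max L₁ L₂ * ‖x - y‖ := by
  have key : ∀ x ∈ ball z δ ∩ C, ∀ y ∈ C \ ball z δ,
      dist (f x) (f y) ≤ max L₁ L₂ * ‖x - y‖ := by
    intro x hx y hy
    let g : ℝ → X := fun t => x + t • (y - x)
    have hg : Continuous g := by fun_prop
    have hg0 : g 0 = x := by simp [g]
    have hg1 : g 1 = y := by simp [g]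
    have hgC : ∀ t ∈ Icc (0:ℝ) 1, g t ∈ C := fun t ht =>
      hCcv.add_smul_sub_mem hx.2 hy.1 ht
    have hcomp : IsCompact (Icc (0:ℝ) 1 ∩ g ⁻¹' (ball z δ)ᶜ) :=
      isCompact_Icc.inter_right ((isOpen_ball.isClosed_compl).preimage hg)
    obtain ⟨s, ⟨hs, hsb⟩, hmin⟩ := hcomp.exists_isLeast
      ⟨1, ⟨by simp, by rw [mem_preimage, hg1]; exact hy.2⟩⟩
    have hs0 : (0:ℝ) ≠ s := by
      rintro rfl
      rw [mem_preimage, hg0] at hsb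
      exact hsb hx.1
    have hA : dist (f x) (f (g s)) ≤ L₁ * (s * ‖x - y‖) := by
      have hcl : closure (Ico (0:ℝ) s) = Icc 0 s := closure_Ico hs0
      have hsub : ∀ t ∈ Icc (0:ℝ) s, t ∈ Icc (0:ℝ) 1 := fun t ht => ⟨ht.1, ht.2.trans hs.2⟩
      refine le_on_closure (s := Ico (0:ℝ) s) (f := fun t => dist (f x) (f (g t)))
        (g := fun t => L₁ * (t * ‖x - y‖)) ?_ ?_ (by fun_prop) (x := s) ?_
      · intro t ht
        have ht1 : t ∈ Icc (0:ℝ) 1 := hsub t ⟨ht.1, ht.2.le⟩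
        have hb : g t ∈ ball z δ := by
          by_contra hb
          exact absurd (hmin ⟨ht1, hb⟩) (not_le.mpr ht.2)
        refine (h₁ x hx (g t) ⟨hb, hgC t ht1⟩).trans_eq ?_
        have : x - g t = t • (x - y) := by simp only [g]; module
        rw [this, norm_smul, Real.norm_of_nonneg ht.1]
      · rw [hcl]
        exact (continuous_const.dist continuous_id : Continuous fun w => dist (f x) w).comp_continuousOn
          (hf.comp hg.continuousOn (fun t ht => hgC t (hsub t ht)))
      · rw [hcl]; exact ⟨hs.1, le_rfl⟩
    have hB : dist (f (g s)) (f y) ≤ L₂ * ((1 - s) * ‖x - y‖) := by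
      refine (h₂ (g s) ⟨hgC s hs, hsb⟩ y hy).trans_eq ?_
      have : g s - y = (1 - s) • (x - y) := by simp only [g]; module
      rw [this, norm_smul, Real.norm_of_nonneg (by linarith [hs.2])]
    have h3 : L₁ * (s * ‖x - y‖) ≤ max L₁ L₂ * (s * ‖x - y‖) :=
      mul_le_mul_of_nonneg_right (le_max_left _ _) (mul_nonneg hs.1 (norm_nonneg _))
    have h4 : L₂ * ((1 - s) * ‖x - y‖) ≤ max L₁ L₂ * ((1 - s) * ‖x - y‖) :=
      mul_le_mul_of_nonneg_right (le_max_right _ _)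
        (mul_nonneg (by linarith [hs.2]) (norm_nonneg _))
    linarith [dist_triangle (f x) (f (g s)) (f y)]
  intro x hx y hy
  by_cases hxb : x ∈ ball z δ <;> by_cases hyb : y ∈ ball z δ
  · exact (h₁ x ⟨hxb, hx⟩ y ⟨hyb, hy⟩).trans
      (mul_le_mul_of_nonneg_right (le_max_left _ _) (norm_nonneg _))
  · exact key x ⟨hxb, hx⟩ y ⟨hy, hyb⟩
  · rw [dist_comm, norm_sub_rev]
    exact key y ⟨hyb, hy⟩ x ⟨hx, hxb⟩
  · exact (h₂ x ⟨hx, hxb⟩ y ⟨hy, hyb⟩).trans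
      (mul_le_mul_of_nonneg_right (le_max_right _ _) (norm_nonneg _))
end

section
/- Let X be a Banach space, x₀ ∈ X and ε > 0. Define r_ε : X → X by r_ε(x) = x if ‖x‖ ≤ ε and r_ε(x) = ε·x/‖x‖ otherwise. Then the map R_{ε,x₀} : X → X defined by R_{ε,x₀}(x) = x − r_ε(x − x₀) is nonexpansive, i.e. ‖R_{ε,x₀}(x) − R_{ε,x₀}(y)‖ ≤ ‖x − y‖ for all x, y ∈ X. -/
open Metric Set

/-- Let `X` be a Banach space, `x₀ ∈ X`, `ε > 0`. With the radial
retraction `r_ε(x) = x` for `‖x‖ ≤ ε` and `r_ε(x) = ε x / ‖x‖` otherwise, the map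
`R_{ε,x₀}(x) = x − r_ε(x − x₀)` is nonexpansive. -/
theorem radial_retraction_perturbation_nonexpansive
    {X : Type*} [NormedAddCommGroup X] [NormedSpace ℝ X] [CompleteSpace X]
    (x₀ : X) (ε : ℝ) (hε : 0 < ε)
    (r : X → X) (hr : ∀ x, r x = if ‖x‖ ≤ ε then x else (ε / ‖x‖) • x)
    (R : X → X) (hR : ∀ x, R x = x - r (x - x₀)) :
    ∀ x y : X, ‖R x - R y‖ ≤ ‖x - y‖ := by
  have key : ∀ u v : X, ‖v‖ ≤ ‖u‖ → ‖(u - r u) - (v - r v)‖ ≤ ‖u - v‖ := by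
    intro u v huv
    have htri : ‖u‖ - ‖v‖ ≤ ‖u - v‖ := norm_sub_norm_le u v
    rw [hr u, hr v]
    by_cases hu : ‖u‖ ≤ ε
    · rw [if_pos hu, if_pos (huv.trans hu)]
      simp
    · rw [if_neg hu]
      push Not at hu
      have hu0 : 0 < ‖u‖ := hε.trans hu
      by_cases hv : ‖v‖ ≤ ε
      · rw [if_pos hv]
        have e : (u - (ε / ‖u‖) • u) - (v - v) = (1 - ε / ‖u‖) • u := by
          module
        have h1 : 0 ≤ 1 - ε / ‖u‖ := by
          rw [sub_nonneg, div_le_one hu0]; exact hu.le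
        rw [e, norm_smul, Real.norm_of_nonneg h1]
        have e2 : (1 - ε / ‖u‖) * ‖u‖ = ‖u‖ - ε := by field_simp
        rw [e2]; linarith [norm_sub_norm_le u v]
      · rw [if_neg hv]
        push Not at hv
        have hv0 : 0 < ‖v‖ := hε.trans hv
        have e : (u - (ε / ‖u‖) • u) - (v - (ε / ‖v‖) • v)
            = (1 - ε / ‖v‖) • (u - v) + (ε / ‖v‖ - ε / ‖u‖) • u := by
          module
        have h1 : 0 ≤ 1 - ε / ‖v‖ := by
          rw [sub_nonneg, div_le_one hv0]; exact hv.le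
        have h2 : 0 ≤ ε / ‖v‖ - ε / ‖u‖ := by
          rw [sub_nonneg]; gcongr
        rw [e]
        refine (norm_add_le _ _).trans ?_
        rw [norm_smul, norm_smul, Real.norm_of_nonneg h1, Real.norm_of_nonneg h2]
        have e2 : (ε / ‖v‖ - ε / ‖u‖) * ‖u‖ = ε / ‖v‖ * (‖u‖ - ‖v‖) := by
          field_simp
        have h3 : ε / ‖v‖ * (‖u‖ - ‖v‖) ≤ ε / ‖v‖ * ‖u - v‖ := by gcongr
        rw [e2]; linarith
  intro x y
  have e : ∀ a b : X, R a - R b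
      = ((a - x₀) - r (a - x₀)) - ((b - x₀) - r (b - x₀)) := by
    intro a b
    rw [hR a, hR b]; abel
  rcases le_total ‖y - x₀‖ ‖x - x₀‖ with h | h
  · have := key _ _ h
    rwa [← e, sub_sub_sub_cancel_right] at this
  · have := key _ _ h
    rw [← e, sub_sub_sub_cancel_right] at this
    rwa [norm_sub_rev (R x), norm_sub_rev x]
end

section
/- Let F : C → 𝒦(C) be nonexpansive, let x₀, z ∈ C and δ > 0 be such that F(x₀) ∩ closedBall(z, δ/2) ≠ ∅. Define μ : C ∩ closedBall(x₀,δ) → [0,1] by μ(x) = (4/(3δ)) · max{0, ‖x−x₀‖ − δ/4}, and define L : C → 𝒦(C) by L(x) = {(1−μ(x))z + μ(x)·a : a ∈ F(x₀) ∩ closedBall(z,δ/2)} for x ∈ C ∩ B(x₀,δ), and L(x) = F(x₀) ∩ closedBall(z,δ/2) for x ∈ C \ B(x₀,δ). Then L is Lipschitz continuous with H(L(x), L(y)) ≤ (2/3)‖x−y‖ for all x, y ∈ C. -/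
open Metric Set Classical
noncomputable section

/-- Let `F : C → 𝒦(C)` be nonexpansive, `x₀, z ∈ C`, `δ > 0` with
`F(x₀) ∩ closedBall(z, δ/2) ≠ ∅`. With `μ(x) = (4/(3δ)) max{0, ‖x−x₀‖ − δ/4}` and
`L(x) = (1−μ(x)){z} + μ(x)(F(x₀) ∩ closedBall(z,δ/2))` for `x ∈ C ∩ B(x₀,δ)`,
`L(x) = F(x₀) ∩ closedBall(z,δ/2)` for `x ∈ C \ B(x₀,δ)`, the map `L` is Lipschitz
with `H(L(x), L(y)) ≤ (2/3)‖x−y‖` on `C`. -/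
theorem mapping_L_lipschitz
    {X : Type*} [NormedAddCommGroup X] [NormedSpace ℝ X] [CompleteSpace X]
    (C : Set X) (hCne : C.Nonempty) (hCcl : IsClosed C)
    (hCbd : Bornology.IsBounded C) (hCcv : Convex ℝ C)
    (F : X → Set X)
    (hFK : ∀ x ∈ C, (F x).Nonempty ∧ IsCompact (F x) ∧ F x ⊆ C)
    (hFne : ∀ x ∈ C, ∀ y ∈ C, hausdorffDist (F x) (F y) ≤ dist x y)
    (x₀ z : X) (hx₀ : x₀ ∈ C) (hz : z ∈ C) (δ : ℝ) (hδ : 0 < δ)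
    (hcap : (F x₀ ∩ closedBall z (δ / 2)).Nonempty)
    (μ : X → ℝ) (hμ : ∀ x, μ x = (4 / (3 * δ)) * max 0 (‖x - x₀‖ - δ / 4))
    (L : X → Set X)
    (hL : ∀ x ∈ C, L x =
      if x ∈ ball x₀ δ then
        (fun a => (1 - μ x) • z + μ x • a) '' (F x₀ ∩ closedBall z (δ / 2))
      else F x₀ ∩ closedBall z (δ / 2)) :
    ∀ x ∈ C, ∀ y ∈ C, hausdorffDist (L x) (L y) ≤ (2 / 3) * ‖x - y‖ := by
  set K := F x₀ ∩ closedBall z (δ / 2) with hK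
  have hLν : ∀ x ∈ C, L x = (fun a => (1 - min 1 (μ x)) • z + min 1 (μ x) • a) '' K := by
    intro x hx
    have e : μ x = max 0 (4 / (3 * δ) * ‖x - x₀‖ - 1 / 3) := by
      rw [hμ x, mul_max_of_nonneg _ _ (by positivity), mul_zero]
      congr 1
      field_simp
    rw [hL x hx]
    split_ifs with h
    · rw [mem_ball, dist_eq_norm] at h
      have h1 : μ x ≤ 1 := by
        rw [e]
        refine max_le zero_le_one ?_
        have : 4 / (3 * δ) * ‖x - x₀‖ ≤ 4 / (3 * δ) * δ := by gcongr
        have h2 : 4 / (3 * δ) * δ = 4 / 3 := by field_simp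
        linarith
      rw [min_eq_right h1]
    · rw [mem_ball, dist_eq_norm, not_lt] at h
      have h1 : 1 ≤ μ x := by
        rw [e]
        refine le_max_of_le_right ?_
        have : 4 / (3 * δ) * δ ≤ 4 / (3 * δ) * ‖x - x₀‖ := by gcongr
        have h2 : 4 / (3 * δ) * δ = 4 / 3 := by field_simp
        linarith
      rw [min_eq_left h1]
      simp
  have hν : ∀ x y, |min 1 (μ x) - min 1 (μ y)| ≤ 4 / (3 * δ) * ‖x - y‖ := by
    intro x y
    have h1 : |min 1 (μ x) - min 1 (μ y)| ≤ |μ x - μ y| := by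
      have := abs_min_sub_min_le_max 1 (μ x) 1 (μ y)
      simpa using this
    refine h1.trans ?_
    rw [hμ x, hμ y, ← mul_sub, abs_mul, abs_of_pos (by positivity : 0 < 4 / (3 * δ))]
    gcongr
    have h2 := abs_max_sub_max_le_max 0 (‖x - x₀‖ - δ / 4) 0 (‖y - x₀‖ - δ / 4)
    have h3 := abs_norm_sub_norm_le (x - x₀) (y - x₀)
    simp only [sub_sub_sub_cancel_right, sub_self, abs_zero] at h2 h3
    exact h2.trans (max_le (norm_nonneg _) h3)
  have key : ∀ x y, ∀ a ∈ K, dist ((1 - min 1 (μ x)) • z + min 1 (μ x) • a)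
      ((1 - min 1 (μ y)) • z + min 1 (μ y) • a) ≤ 2 / 3 * ‖x - y‖ := by
    intro x y a ha
    have ha2 : ‖a - z‖ ≤ δ / 2 := by
      have := ha.2
      rwa [mem_closedBall, dist_eq_norm] at this
    have e : ((1 - min 1 (μ x)) • z + min 1 (μ x) • a) -
      ((1 - min 1 (μ y)) • z + min 1 (μ y) • a) = (min 1 (μ x) - min 1 (μ y)) • (a - z) := by
      module
    rw [dist_eq_norm, e, norm_smul, Real.norm_eq_abs]
    calc _ ≤ (4 / (3 * δ) * ‖x - y‖) * (δ / 2) := by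
          gcongr
          exact hν x y
      _ = _ := by field_simp; ring
  intro x hx y hy
  rw [hLν x hx, hLν y hy]
  refine hausdorffDist_le_of_mem_dist (by positivity) ?_ ?_
  · rintro _ ⟨a, ha, rfl⟩
    exact ⟨_, ⟨a, ha, rfl⟩, key x y a ha⟩
  · rintro _ ⟨a, ha, rfl⟩
    refine ⟨_, ⟨a, ha, rfl⟩, ?_⟩
    rw [norm_sub_rev]
    exact key y x a ha
end
end

section
/- Let F : C → 𝒦(C) be nonexpansive and let x₀ ∈ C satisfy x₀ ∈ F(x₀). Then for every ε ∈ (0, diam(C)) and every r with 0 < r ≤ ε/24 there exists a nonexpansive map G : C → 𝒦(C) with sup_{x∈C} H(F(x), G(x)) < ε such that x₀ ∈ G(x₀), and for all v ∈ B(x₀, r) one has P_{G(v)}(v) = {x₀} and G(v) ∩ B(x₀, r) = {x₀}. -/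
open Metric Set

lemma hd_le_gamma {X : Type*} [NormedAddCommGroup X] [NormedSpace ℝ X]
    (K : Set X) (x₀ : X) (R : ℝ) (hR : 0 ≤ R) (s t : ℝ) :
    hausdorffDist
      ((K \ ball x₀ R) ∪ (fun k => x₀ + s • (k - x₀)) '' (K ∩ closedBall x₀ R))
      ((K \ ball x₀ R) ∪ (fun k => x₀ + t • (k - x₀)) '' (K ∩ closedBall x₀ R))
      ≤ |s - t| * R := by
  have key : ∀ s t : ℝ, ∀ x ∈ (K \ ball x₀ R) ∪ (fun k => x₀ + s • (k - x₀)) '' (K ∩ closedBall x₀ R),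
      ∃ y ∈ (K \ ball x₀ R) ∪ (fun k => x₀ + t • (k - x₀)) '' (K ∩ closedBall x₀ R),
        dist x y ≤ |s - t| * R := by
    rintro s t x (hx | ⟨k, hk, rfl⟩)
    · exact ⟨x, Or.inl hx, by rw [dist_self]; positivity⟩
    · refine ⟨_, Or.inr ⟨k, hk, rfl⟩, ?_⟩
      have : (x₀ + s • (k - x₀)) - (x₀ + t • (k - x₀)) = (s - t) • (k - x₀) := by module
      simp only [dist_eq_norm]
      rw [this, norm_smul, Real.norm_eq_abs]
      have h2 := hk.2
      rw [mem_closedBall, dist_eq_norm] at h2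
      gcongr
  apply hausdorffDist_le_of_mem_dist (by positivity) (key s t)
  rw [abs_sub_comm]
  exact key t s

lemma shrink_nonexp {X : Type*} [NormedAddCommGroup X] [NormedSpace ℝ X]
    (ρ : ℝ) (hρ : 0 < ρ) (x y : X) (hy : ρ ≤ ‖y‖) (hxy : ‖y‖ ≤ ‖x‖) :
    ‖(1 - ρ / ‖x‖) • x - (1 - ρ / ‖y‖) • y‖ ≤ ‖x - y‖ := by
  have hy0 : 0 < ‖y‖ := by linarith
  have hx0 : 0 < ‖x‖ := by linarith
  have e : (1 - ρ / ‖x‖) • x - (1 - ρ / ‖y‖) • y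
      = (1 - ρ / ‖x‖) • (x - y) + (ρ / ‖y‖ - ρ / ‖x‖) • y := by module
  have h1 : 0 ≤ 1 - ρ / ‖x‖ := by
    rw [sub_nonneg, div_le_one hx0]; linarith
  have h2 : 0 ≤ ρ / ‖y‖ - ρ / ‖x‖ := by
    rw [sub_nonneg]; gcongr
  rw [e]
  refine (norm_add_le _ _).trans ?_
  rw [norm_smul, norm_smul, Real.norm_of_nonneg h1, Real.norm_of_nonneg h2]
  have h3 : (ρ / ‖y‖ - ρ / ‖x‖) * ‖y‖ = ρ / ‖x‖ * (‖x‖ - ‖y‖) := by field_simp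
  have h4 : ‖x‖ - ‖y‖ ≤ ‖x - y‖ := norm_sub_norm_le x y
  have h5 : ρ / ‖x‖ * (‖x‖ - ‖y‖) ≤ ρ / ‖x‖ * ‖x - y‖ := by gcongr
  rw [h3]; linarith

/-- Let `F : C → 𝒦(C)` be nonexpansive with `x₀ ∈ F(x₀)`. For every
`ε ∈ (0, diam C)` and every `r` with `0 < r ≤ ε/24` there is a nonexpansive
`G : C → 𝒦(C)` with `sup_{x∈C} H(F(x),G(x)) < ε`, `x₀ ∈ G(x₀)`, and for all
`v ∈ B(x₀,r)` one has `P_{G(v)}(v) = {x₀}` and `G(v) ∩ B(x₀,r) = {x₀}`. -/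
theorem make_fixed_point_isolated
    {X : Type*} [NormedAddCommGroup X] [NormedSpace ℝ X] [CompleteSpace X]
    (C : Set X) (hCne : C.Nonempty) (hCcl : IsClosed C)
    (hCbd : Bornology.IsBounded C) (hCcv : Convex ℝ C)
    (F : X → Set X)
    (hFK : ∀ x ∈ C, (F x).Nonempty ∧ IsCompact (F x) ∧ F x ⊆ C)
    (hFne : ∀ x ∈ C, ∀ y ∈ C, hausdorffDist (F x) (F y) ≤ dist x y)
    (x₀ : X) (hx₀ : x₀ ∈ C) (hfix : x₀ ∈ F x₀)
    (ε : ℝ) (hε : ε ∈ Set.Ioo (0 : ℝ) (diam C))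
    (r : ℝ) (hr0 : 0 < r) (hr : r ≤ ε / 24) :
    ∃ G : X → Set X,
      (∀ x ∈ C, (G x).Nonempty ∧ IsCompact (G x) ∧ G x ⊆ C) ∧
      (∀ x ∈ C, ∀ y ∈ C, hausdorffDist (G x) (G y) ≤ dist x y) ∧
      (∃ ε' < ε, ∀ x ∈ C, hausdorffDist (F x) (G x) ≤ ε') ∧
      x₀ ∈ G x₀ ∧
      ∀ v ∈ ball x₀ r ∩ C, projSet (G v) v = {x₀} ∧ G v ∩ ball x₀ r = {x₀} := by
  classical
  obtain ⟨hKne, hKc, hKC⟩ := hFK x₀ hx₀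
  set K := F x₀ with hK
  let Γ : ℝ → Set X := fun s =>
    (K \ ball x₀ (2 * r)) ∪ (fun k => x₀ + s • (k - x₀)) '' (K ∩ closedBall x₀ (2 * r))
  have hΓ : ∀ s t, hausdorffDist (Γ s) (Γ t) ≤ |s - t| * (2 * r) := fun s t =>
    hd_le_gamma K x₀ (2 * r) (by positivity) s t
  have hx₀b : x₀ ∈ K ∩ closedBall x₀ (2 * r) := ⟨hfix, mem_closedBall_self (by positivity)⟩
  have hΓ0 : Γ 0 = (K \ ball x₀ (2 * r)) ∪ {x₀} := by
    have : (fun k => x₀ + (0 : ℝ) • (k - x₀)) '' (K ∩ closedBall x₀ (2 * r)) = {x₀} := by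
      simp only [zero_smul, add_zero]
      exact Set.Nonempty.image_const ⟨x₀, hx₀b⟩ x₀
    simp only [Γ, this]
  have hΓ1 : Γ 1 = K := by
    have : (fun k => x₀ + (1 : ℝ) • (k - x₀)) '' (K ∩ closedBall x₀ (2 * r))
        = K ∩ closedBall x₀ (2 * r) := by
      simp
    simp only [Γ, this]
    ext z
    simp only [mem_union, mem_diff, mem_inter_iff, mem_ball, mem_closedBall]
    constructor
    · tauto
    · intro hz
      by_cases h : dist z x₀ < 2 * r
      · exact Or.inr ⟨hz, h.le⟩
      · exact Or.inl ⟨hz, h⟩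
  have hΓx : ∀ s, x₀ ∈ Γ s := fun s => Or.inr ⟨x₀, hx₀b, by simp⟩
  have hΓc : ∀ s, IsCompact (Γ s) := by
    intro s
    refine (hKc.diff isOpen_ball).union ?_
    exact (hKc.inter_right isClosed_closedBall).image (by fun_prop)
  have hseg : ∀ s : ℝ, 0 ≤ s → s ≤ 1 → ∀ k ∈ C, x₀ + s • (k - x₀) ∈ C :=
    fun s h0 h1 k hk => hCcv.add_smul_sub_mem hx₀ hk ⟨h0, h1⟩
  have hΓC : ∀ s, 0 ≤ s → s ≤ 1 → Γ s ⊆ C := by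
    rintro s h0 h1 z (hz | ⟨k, hk, rfl⟩)
    · exact hKC hz.1
    · exact hseg s h0 h1 k (hKC hk.1)
  let σ : X → X := fun x => x₀ + (1 - (3 * r) / ‖x - x₀‖) • (x - x₀)
  let S : X → ℝ := fun x => max 0 ((‖x - x₀‖ - r) / (2 * r))
  have hS0 : ∀ x, 0 ≤ S x := fun x => le_max_left _ _
  have hS1 : ∀ x, ‖x - x₀‖ ≤ 3 * r → S x ≤ 1 := by
    intro x hx
    refine max_le zero_le_one ?_
    rw [div_le_one (by positivity)]; linarith
  have hSd : ∀ x y, |S x - S y| * (2 * r) ≤ ‖x - y‖ := by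
    intro x y
    have h1 : |S x - S y| ≤ |(‖x - x₀‖ - r) / (2 * r) - (‖y - x₀‖ - r) / (2 * r)| := by
      have := abs_max_sub_max_le_max (0 : ℝ) ((‖x - x₀‖ - r) / (2 * r)) 0 ((‖y - x₀‖ - r) / (2 * r))
      simpa [S] using this
    have h2 : (‖x - x₀‖ - r) / (2 * r) - (‖y - x₀‖ - r) / (2 * r)
        = (‖x - x₀‖ - ‖y - x₀‖) / (2 * r) := by ring
    rw [h2, abs_div, abs_of_pos (by positivity : 0 < 2 * r), le_div_iff₀ (by positivity)] at h1
    refine h1.trans ((abs_norm_sub_norm_le _ _).trans ?_)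
    rw [sub_sub_sub_cancel_right]
  have hσC : ∀ x ∈ C, 3 * r < ‖x - x₀‖ → σ x ∈ C := by
    intro x hx h
    have h0 : 0 < ‖x - x₀‖ := by linarith
    refine hseg _ ?_ ?_ x hx
    · rw [sub_nonneg, div_le_one h0]; exact h.le
    · have : 0 ≤ 3 * r / ‖x - x₀‖ := by positivity
      linarith
  have hσ0 : ∀ x, 3 * r < ‖x - x₀‖ → dist x₀ (σ x) = ‖x - x₀‖ - 3 * r := by
    intro x h
    have h0 : 0 < ‖x - x₀‖ := by linarith
    have h1 : 0 ≤ 1 - 3 * r / ‖x - x₀‖ := by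
      rw [sub_nonneg, div_le_one h0]; exact h.le
    rw [dist_comm, dist_eq_norm]
    simp only [σ, add_sub_cancel_left]
    rw [norm_smul, Real.norm_of_nonneg h1]
    field_simp
  have hσx : ∀ x, 3 * r < ‖x - x₀‖ → dist x (σ x) = 3 * r := by
    intro x h
    have h0 : 0 < ‖x - x₀‖ := by linarith
    have e : x - σ x = (3 * r / ‖x - x₀‖) • (x - x₀) := by
      simp only [σ]; module
    rw [dist_eq_norm, e, norm_smul, Real.norm_of_nonneg (by positivity)]
    field_simp
  have hσd : ∀ x y, 3 * r < ‖x - x₀‖ → 3 * r < ‖y - x₀‖ → dist (σ x) (σ y) ≤ dist x y := by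
    have key : ∀ x y, 3 * r < ‖y - x₀‖ → ‖y - x₀‖ ≤ ‖x - x₀‖ → dist (σ x) (σ y) ≤ dist x y := by
      intro x y hy hxy
      have := shrink_nonexp (3 * r) (by positivity) (x - x₀) (y - x₀) hy.le hxy
      rw [dist_eq_norm, dist_eq_norm]
      simpa [σ] using this
    intro x y hx hy
    rcases le_total ‖y - x₀‖ ‖x - x₀‖ with h | h
    · exact key x y hy h
    · rw [dist_comm, dist_comm x y]; exact key y x hx h
  have tri : ∀ A B D : Set X, A.Nonempty → A ⊆ C → B.Nonempty → B ⊆ C →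
      hausdorffDist A D ≤ hausdorffDist A B + hausdorffDist B D := by
    intro A B D hA hAC hB hBC
    exact hausdorffDist_triangle
      (hausdorffEDist_ne_top_of_nonempty_of_bounded hA hB (hCbd.subset hAC) (hCbd.subset hBC))
  have cross : ∀ x ∈ C, ∀ y ∈ C, ‖x - x₀‖ ≤ 3 * r → 3 * r < ‖y - x₀‖ →
      hausdorffDist (Γ (S x)) (F (σ y)) ≤ dist x y := by
    intro x hx y hy hxr hyr
    have h1 := tri (Γ (S x)) K (F (σ y)) ⟨x₀, hΓx _⟩ (hΓC _ (hS0 x) (hS1 x hxr)) hKne hKC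
    have h2 : hausdorffDist (Γ (S x)) K ≤ 3 * r - ‖x - x₀‖ := by
      have h3 := hΓ (S x) 1
      rw [hΓ1, abs_of_nonpos (by linarith [hS1 x hxr])] at h3
      have h4 : (‖x - x₀‖ - r) / (2 * r) ≤ S x := le_max_right _ _
      rw [div_le_iff₀ (by positivity)] at h4
      linarith
    have h5 := hFne x₀ hx₀ (σ y) (hσC y hy hyr)
    rw [hσ0 y hyr] at h5
    have h6 : ‖y - x₀‖ - ‖x - x₀‖ ≤ dist x y := by
      have := norm_sub_norm_le (y - x₀) (x - x₀)
      rwa [sub_sub_sub_cancel_right, ← dist_eq_norm y x, dist_comm y x] at this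
    linarith
  refine ⟨fun x => if ‖x - x₀‖ ≤ 3 * r then Γ (S x) else F (σ x), ?_, ?_, ⟨5 * r, by linarith, ?_⟩,
    ?_, ?_⟩
  · intro x hx
    dsimp only
    split_ifs with h
    · exact ⟨⟨x₀, hΓx _⟩, hΓc _, hΓC _ (hS0 x) (hS1 x h)⟩
    · exact hFK _ (hσC x hx (not_le.1 h))
  · intro x hx y hy
    dsimp only
    split_ifs with h h' h'
    · rw [dist_eq_norm]
      exact (hΓ _ _).trans (hSd x y)
    · exact cross x hx y hy h (not_le.1 h')
    · rw [hausdorffDist_comm, dist_comm]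
      exact cross y hy x hx h' (not_le.1 h)
    · exact (hFne _ (hσC x hx (not_le.1 h)) _ (hσC y hy (not_le.1 h'))).trans
        (hσd x y (not_le.1 h) (not_le.1 h'))
  · intro x hx
    dsimp only
    split_ifs with h
    · have h1 := tri (F x) K (Γ (S x)) (hFK x hx).1 (hFK x hx).2.2 hKne hKC
      have h2 := hFne x hx x₀ hx₀
      rw [dist_eq_norm] at h2
      have h3 := hΓ 1 (S x)
      rw [hΓ1, abs_of_nonneg (by linarith [hS1 x h])] at h3
      have h4 := mul_nonneg (hS0 x) hr0.le
      rw [← hK] at h2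
      linarith
    · have h2 := hFne x hx _ (hσC x hx (not_le.1 h))
      rw [hσx x (not_le.1 h)] at h2
      linarith
  · dsimp only
    rw [if_pos (by simp; positivity)]
    exact hΓx _
  · rintro v ⟨hv, hvC⟩
    rw [mem_ball, dist_eq_norm] at hv
    have hG : (if ‖v - x₀‖ ≤ 3 * r then Γ (S v) else F (σ v)) = (K \ ball x₀ (2 * r)) ∪ {x₀} := by
      rw [if_pos (by linarith), ← hΓ0]
      congr 1
      refine max_eq_left (div_nonpos_of_nonpos_of_nonneg (by linarith) (by positivity))
    dsimp only
    rw [hG]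
    set M := (K \ ball x₀ (2 * r)) ∪ {x₀} with hM
    have hxM : x₀ ∈ M := Or.inr rfl
    rw [← dist_eq_norm] at hv
    have far : ∀ y ∈ M, y ≠ x₀ → 2 * r ≤ dist y x₀ := by
      rintro y (hy | hy) hne
      · simpa using hy.2
      · exact absurd hy hne
    have hinf : infDist v M = dist v x₀ := by
      apply le_antisymm (infDist_le_dist_of_mem hxM)
      rw [le_infDist ⟨x₀, hxM⟩]
      intro y hy
      by_cases h : y = x₀
      · rw [h]
      · have := far y hy h
        have := dist_triangle_left y x₀ v
        linarith
    constructor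
    · ext y
      simp only [projSet, mem_setOf_eq, mem_singleton_iff, hinf]
      constructor
      · rintro ⟨hy, hd⟩
        by_contra h
        have := far y hy h
        have := dist_triangle_left y x₀ v
        linarith
      · rintro rfl
        exact ⟨hxM, rfl⟩
    · ext y
      simp only [mem_inter_iff, mem_ball, mem_singleton_iff]
      constructor
      · rintro ⟨hy, hd⟩
        by_contra h
        have := far y hy h
        linarith
      · rintro rfl
        exact ⟨hxM, by simpa using hr0⟩
end

section
/- Let x₀ ∈ C, let F : C → 𝒦(C) be nonexpansive, and let ε satisfy 0 < ε < diam(C). Then there exist a nonexpansive map G : C → 𝒦(C) and a radius r > 0 such that sup_{x∈C} H(F(x), G(x)) < ε and for every v ∈ B(x₀, r) one has v ∉ G(v). -/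
open Metric Set

lemma soft_aux {X : Type*} [NormedAddCommGroup X] [NormedSpace ℝ X] (r : ℝ) (hr : 0 < r)
    (x y : X) (hx : r ≤ ‖x‖) (hxy : ‖x‖ ≤ ‖y‖) :
    ‖(1 - r / ‖x‖) • x - (1 - r / ‖y‖) • y‖ ≤ ‖x - y‖ := by
  have hx0 : 0 < ‖x‖ := lt_of_lt_of_le hr hx
  have hy0 : 0 < ‖y‖ := lt_of_lt_of_le hx0 hxy
  have e : (1 - r / ‖x‖) • x - (1 - r / ‖y‖) • y
      = (1 - r / ‖x‖) • (x - y) - (r / ‖x‖ - r / ‖y‖) • y := by module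
  have h1 : 0 ≤ 1 - r / ‖x‖ := by
    have : r / ‖x‖ ≤ 1 := (div_le_one hx0).2 hx
    linarith
  have h2 : 0 ≤ r / ‖x‖ - r / ‖y‖ := by
    have : r / ‖y‖ ≤ r / ‖x‖ := by gcongr
    linarith
  have h3 : (r / ‖x‖ - r / ‖y‖) * ‖y‖ = r / ‖x‖ * (‖y‖ - ‖x‖) := by
    field_simp
  have h4 : ‖y‖ - ‖x‖ ≤ ‖x - y‖ := by
    rw [norm_sub_rev]; exact norm_sub_norm_le y x
  have h5 : r / ‖x‖ * (‖y‖ - ‖x‖) ≤ r / ‖x‖ * ‖x - y‖ := by gcongr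
  rw [e]
  refine (norm_sub_le _ _).trans ?_
  rw [norm_smul, norm_smul, Real.norm_of_nonneg h1, Real.norm_of_nonneg h2, h3]
  linarith

lemma soft_ne {X : Type*} [NormedAddCommGroup X] [NormedSpace ℝ X] (r : ℝ) (hr : 0 < r)
    (x y : X) (hx : r ≤ ‖x‖) (hy : r ≤ ‖y‖) :
    ‖(1 - r / ‖x‖) • x - (1 - r / ‖y‖) • y‖ ≤ ‖x - y‖ := by
  rcases le_total ‖x‖ ‖y‖ with h | h
  · exact soft_aux r hr x y hx h
  · rw [norm_sub_rev, norm_sub_rev x y]; exact soft_aux r hr y x hy h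

lemma exists_avoid {X : Type*} [NormedAddCommGroup X] [NormedSpace ℝ X]
    (C : Set X) (hCcv : Convex ℝ C) (x₀ : X) (hx₀ : x₀ ∈ C) (hd : 0 < diam C)
    (A : Set X) (hA : IsCompact A) (hAC : A ⊆ C) (r : ℝ) (hr : 0 < r) :
    ∃ B : Set X, B.Finite ∧ B ⊆ C ∧ x₀ ∉ B ∧ (∀ a ∈ A, ∃ b ∈ B, dist a b ≤ r) ∧
      (∀ b ∈ B, ∃ a ∈ A, dist a b ≤ r) := by
  classical
  obtain ⟨q, hq, hqx⟩ : ∃ q ∈ C, q ≠ x₀ := by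
    by_contra! h
    have : C.Subsingleton := fun a ha b hb => (h a ha).trans (h b hb).symm
    rw [diam_subsingleton this] at hd
    exact lt_irrefl _ hd
  have hn : 0 < ‖q - x₀‖ := norm_pos_iff.2 (sub_ne_zero.2 hqx)
  set τ : ℝ := (r / 2) / (r / 2 + ‖q - x₀‖) with hτ
  have hτ0 : 0 < τ := by positivity
  have hτ1 : τ ≤ 1 := by
    rw [hτ, div_le_one (by positivity)]; linarith
  have hτn : τ * ‖q - x₀‖ ≤ r / 2 := by
    rw [hτ, div_mul_eq_mul_div, div_le_iff₀ (by positivity)]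
    nlinarith
  set p : X := x₀ + τ • (q - x₀) with hp
  have hpC : p ∈ C := hCcv.add_smul_sub_mem hx₀ hq ⟨hτ0.le, hτ1⟩
  have hpx : p ≠ x₀ := by
    intro h
    have : τ • (q - x₀) = 0 := by simpa [hp] using h
    rcases smul_eq_zero.1 this with h | h
    · exact hτ0.ne' h
    · exact hqx (sub_eq_zero.1 h)
  have hpd : dist x₀ p ≤ r / 2 := by
    rw [dist_comm, dist_eq_norm, hp, add_sub_cancel_left, norm_smul, Real.norm_of_nonneg hτ0.le]
    exact hτn
  let φ : X → X := fun c => if c = x₀ then p else c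
  have hφd : ∀ c, dist c (φ c) ≤ r / 2 := by
    intro c
    by_cases h : c = x₀
    · simp [φ, h, hpd]
    · simp [φ, h]; positivity
  obtain ⟨t, htA, htf, htc⟩ := hA.finite_cover_balls (half_pos hr)
  refine ⟨φ '' t, htf.image φ, ?_, ?_, ?_, ?_⟩
  · rintro _ ⟨c, hc, rfl⟩
    by_cases h : c = x₀
    · simp [φ, h, hpC]
    · simp [φ, h]; exact hAC (htA hc)
  · rintro ⟨c, hc, h1⟩
    by_cases h : c = x₀
    · simp [φ, h] at h1; exact hpx h1
    · simp [φ, h] at h1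
  · intro a ha
    obtain ⟨c, hc, hac⟩ := mem_iUnion₂.1 (htc ha)
    refine ⟨φ c, mem_image_of_mem _ hc, ?_⟩
    have := dist_triangle a c (φ c)
    have := hφd c
    have := mem_ball.1 hac
    linarith
  · rintro _ ⟨c, hc, rfl⟩
    exact ⟨c, htA hc, by linarith [hφd c]⟩


/-- Let `x₀ ∈ C`, `F : C → 𝒦(C)` nonexpansive and `0 < ε < diam C`.
Then there are a nonexpansive `G : C → 𝒦(C)` and `r > 0` with
`sup_{x∈C} H(F(x),G(x)) < ε` such that no `v ∈ B(x₀,r)` is a fixed point of `G`. -/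
theorem typical_no_fixed_point_near
    {X : Type*} [NormedAddCommGroup X] [NormedSpace ℝ X] [CompleteSpace X]
    (C : Set X) (hCne : C.Nonempty) (hCcl : IsClosed C)
    (hCbd : Bornology.IsBounded C) (hCcv : Convex ℝ C)
    (x₀ : X) (hx₀ : x₀ ∈ C)
    (F : X → Set X)
    (hFK : ∀ x ∈ C, (F x).Nonempty ∧ IsCompact (F x) ∧ F x ⊆ C)
    (hFne : ∀ x ∈ C, ∀ y ∈ C, hausdorffDist (F x) (F y) ≤ dist x y)
    (ε : ℝ) (hε : ε ∈ Set.Ioo (0 : ℝ) (diam C)) :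
    ∃ G : X → Set X, ∃ r > (0 : ℝ),
      (∀ x ∈ C, (G x).Nonempty ∧ IsCompact (G x) ∧ G x ⊆ C) ∧
      (∀ x ∈ C, ∀ y ∈ C, hausdorffDist (G x) (G y) ≤ dist x y) ∧
      (∃ ε' < ε, ∀ x ∈ C, hausdorffDist (F x) (G x) ≤ ε') ∧
      ∀ v ∈ ball x₀ r ∩ C, v ∉ G v := by
  classical
  obtain ⟨hε0, hεd⟩ := hε
  set A := F x₀ with hAdef
  obtain ⟨hAne, hAc, hAC⟩ := hFK x₀ hx₀
  set r : ℝ := ε / 4 with hrdef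
  have hr : 0 < r := by positivity
  obtain ⟨B, hBf, hBC, hxB, hAB, hBA⟩ :=
    exists_avoid C hCcv x₀ hx₀ (hε0.trans hεd) A hAc hAC r hr
  let P : Set (X × X) := (A ×ˢ B) ∩ {p | dist p.1 p.2 ≤ r}
  have hPc : IsCompact P :=
    (hAc.prod hBf.isCompact).inter_right (isClosed_le (by fun_prop) (by fun_prop))
  have hPne : P.Nonempty := by
    obtain ⟨a, ha⟩ := hAne
    obtain ⟨b, hb, hab⟩ := hAB a ha
    exact ⟨(a, b), ⟨ha, hb⟩, hab⟩
  let m : ℝ → X × X → X := fun s p => p.1 + s • (p.2 - p.1)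
  let ρ : X → X := fun x => x₀ + (1 - r / ‖x - x₀‖) • (x - x₀)
  let σ : X → ℝ := fun x => 1 - ‖x - x₀‖ / r
  have hm : ∀ s s' : ℝ, ∀ p ∈ P, dist (m s p) (m s' p) ≤ |s - s'| * r := by
    intro s s' p hp
    have e : m s p - m s' p = (s - s') • (p.2 - p.1) := by simp only [m]; module
    rw [dist_eq_norm, e, norm_smul, Real.norm_eq_abs]
    have : ‖p.2 - p.1‖ ≤ r := by
      rw [← dist_eq_norm, dist_comm]; exact hp.2
    gcongr
  have hm0 : m 0 '' P = A := by
    ext a; constructor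
    · rintro ⟨p, hp, rfl⟩; simpa [m] using hp.1.1
    · intro ha
      obtain ⟨b, hb, hab⟩ := hAB a ha
      exact ⟨(a, b), ⟨⟨ha, hb⟩, hab⟩, by simp [m]⟩
  have hmH : ∀ s s' : ℝ, hausdorffDist (m s '' P) (m s' '' P) ≤ |s - s'| * r := by
    intro s s'
    apply hausdorffDist_le_of_mem_dist (by positivity)
    · rintro _ ⟨p, hp, rfl⟩; exact ⟨_, mem_image_of_mem _ hp, hm _ _ p hp⟩
    · rintro _ ⟨p, hp, rfl⟩
      exact ⟨_, mem_image_of_mem _ hp, by rw [dist_comm]; exact hm _ _ p hp⟩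
  have hmK : ∀ s : ℝ, 0 ≤ s → s ≤ 1 →
      (m s '' P).Nonempty ∧ IsCompact (m s '' P) ∧ m s '' P ⊆ C := by
    intro s h0 h1
    refine ⟨hPne.image _, hPc.image (by fun_prop), ?_⟩
    rintro _ ⟨p, hp, rfl⟩
    exact hCcv.add_smul_sub_mem (hAC hp.1.1) (hBC hp.1.2) ⟨h0, h1⟩
  have hσ0 : ∀ x, ‖x - x₀‖ < r → 0 ≤ σ x := by
    intro x hx
    have : ‖x - x₀‖ / r ≤ 1 := (div_le_one hr).2 hx.le
    simp only [σ]; linarith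
  have hσ1 : ∀ x, σ x ≤ 1 := by
    intro x
    have : 0 ≤ ‖x - x₀‖ / r := by positivity
    simp only [σ]; linarith
  have hσr : ∀ x, σ x * r = r - ‖x - x₀‖ := by
    intro x; simp only [σ]; field_simp
  have hρc : ∀ x, r ≤ ‖x - x₀‖ → 0 ≤ 1 - r / ‖x - x₀‖ ∧ 1 - r / ‖x - x₀‖ ≤ 1 := by
    intro x hx
    have h1 : r / ‖x - x₀‖ ≤ 1 := (div_le_one (hr.trans_le hx)).2 hx
    have h2 : 0 ≤ r / ‖x - x₀‖ := by positivity
    constructor <;> linarith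
  have hρC : ∀ x ∈ C, r ≤ ‖x - x₀‖ → ρ x ∈ C := by
    intro x hx h
    exact hCcv.add_smul_sub_mem hx₀ hx (hρc x h)
  have hρ0 : ∀ x, r ≤ ‖x - x₀‖ → dist x₀ (ρ x) = ‖x - x₀‖ - r := by
    intro x h
    have h0 := hr.trans_le h
    rw [dist_comm, dist_eq_norm]
    simp only [ρ, add_sub_cancel_left]
    rw [norm_smul, Real.norm_of_nonneg (hρc x h).1]
    field_simp
  have hρx : ∀ x, r ≤ ‖x - x₀‖ → dist x (ρ x) = r := by
    intro x h
    have h0 := hr.trans_le h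
    have e : x - ρ x = (r / ‖x - x₀‖) • (x - x₀) := by simp only [ρ]; module
    rw [dist_eq_norm, e, norm_smul, Real.norm_of_nonneg (by positivity)]
    field_simp
  have hfin : ∀ S T : Set X, (S.Nonempty ∧ IsCompact S ∧ S ⊆ C) →
      (T.Nonempty ∧ IsCompact T ∧ T ⊆ C) → hausdorffEDist S T ≠ ⊤ := by
    intro S T hS hT
    exact hausdorffEDist_ne_top_of_nonempty_of_bounded hS.1 hT.1 hS.2.1.isBounded hT.2.1.isBounded
  let G : X → Set X := fun x => if ‖x - x₀‖ < r then m (σ x) '' P else F (ρ x)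
  have hGi : ∀ x, ‖x - x₀‖ < r → G x = m (σ x) '' P := fun x h => by simp only [G, if_pos h]
  have hGo : ∀ x, r ≤ ‖x - x₀‖ → G x = F (ρ x) := fun x h => by
    simp only [G, if_neg (not_lt.2 h)]
  have hGK : ∀ x ∈ C, (G x).Nonempty ∧ IsCompact (G x) ∧ G x ⊆ C := by
    intro x hx
    rcases lt_or_ge ‖x - x₀‖ r with h | h
    · rw [hGi x h]; exact hmK _ (hσ0 x h) (hσ1 x)
    · rw [hGo x h]; exact hFK _ (hρC x hx h)
  have hGA : ∀ x, ‖x - x₀‖ < r → hausdorffDist (G x) A ≤ r - ‖x - x₀‖ := by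
    intro x h
    have := hmH (σ x) 0
    rw [hm0, sub_zero, abs_of_nonneg (hσ0 x h), hσr] at this
    rw [hGi x h]; exact this
  have hmix : ∀ x ∈ C, ∀ y ∈ C, ‖x - x₀‖ < r → r ≤ ‖y - x₀‖ →
      hausdorffDist (G x) (G y) ≤ dist x y := by
    intro x hx y hy h h'
    have h1 := hausdorffDist_triangle (u := G y) (hfin _ _ (hGK x hx) (hFK x₀ hx₀))
    have h2 := hGA x h
    have h3 := hFne x₀ hx₀ _ (hρC y hy h')
    rw [hρ0 y h', ← hGo y h'] at h3
    have h4 : ‖y - x₀‖ - ‖x - x₀‖ ≤ dist x y := by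
      rw [dist_comm, dist_eq_norm]
      have := norm_sub_norm_le (y - x₀) (x - x₀)
      rwa [sub_sub_sub_cancel_right] at this
    linarith
  obtain ⟨d, hd, hdB⟩ := Metric.isOpen_iff.1 hBf.isClosed.isOpen_compl x₀ hxB
  refine ⟨G, min r (d / 2), by positivity, hGK, ?_, ⟨2 * r, by linarith, ?_⟩, ?_⟩
  · intro x hx y hy
    rcases lt_or_ge ‖x - x₀‖ r with h | h <;> rcases lt_or_ge ‖y - x₀‖ r with h' | h'
    · rw [hGi x h, hGi y h']
      refine (hmH _ _).trans ?_
      rw [← abs_of_pos hr, ← abs_mul, sub_mul, hσr, hσr]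
      have := abs_norm_sub_norm_le (y - x₀) (x - x₀)
      rw [sub_sub_sub_cancel_right] at this
      rw [sub_sub_sub_cancel_left, dist_comm, dist_eq_norm]
      exact this
    · exact hmix x hx y hy h h'
    · rw [hausdorffDist_comm, dist_comm]; exact hmix y hy x hx h' h
    · rw [hGo x h, hGo y h']
      refine (hFne _ (hρC x hx h) _ (hρC y hy h')).trans ?_
      have := soft_ne r hr _ _ h h'
      rw [sub_sub_sub_cancel_right] at this
      simpa only [ρ, dist_eq_norm, add_sub_add_left_eq_sub] using this
  · intro x hx
    rcases lt_or_ge ‖x - x₀‖ r with h | h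
    · have h1 := hausdorffDist_triangle (u := G x) (hfin _ _ (hFK x hx) (hFK x₀ hx₀))
      have h2 := hGA x h
      rw [hausdorffDist_comm] at h2
      have h3 := hFne x hx x₀ hx₀
      rw [dist_eq_norm] at h3
      linarith
    · have h3 := hFne x hx _ (hρC x hx h)
      rw [hρx x h, ← hGo x h] at h3
      linarith
  · rintro v ⟨hv, hvC⟩ hvG
    have hv1 : ‖v - x₀‖ < r := by
      rw [← dist_eq_norm]; exact (mem_ball.1 hv).trans_le (min_le_left _ _)
    have hv2 : dist v x₀ < d / 2 := (mem_ball.1 hv).trans_le (min_le_right _ _)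
    rw [hGi v hv1] at hvG
    obtain ⟨p, hp, hpv⟩ := hvG
    have h1 := hm (σ v) 1 p hp
    have e1 : m 1 p = p.2 := by simp [m]
    have e2 : |σ v - 1| * r = ‖v - x₀‖ := by
      rw [abs_sub_comm, abs_of_nonneg (by linarith [hσ1 v]), sub_mul, hσr]; ring
    rw [hpv, e1, e2, ← dist_eq_norm] at h1
    have h2 := dist_triangle p.2 v x₀
    rw [dist_comm p.2 v] at h2
    exact hdB (mem_ball.2 (by linarith : dist p.2 x₀ < d)) hp.1.2
end

section
/- Let G : C → 𝒦(C) satisfy H(G(x),G(y)) ≤ L‖x−y‖ for all x,y ∈ C with some L ∈ [0,1), let z ∈ C with z ∉ G(z), set δ := dist(z, G(z)), let σ ∈ (0, δ/2) and ε' := (1−L)σ/4. Then there exist a map G̃ : C → 𝒦(C) and a point z̃ ∈ C \ G(z) such that: (i) G̃(z) = G(z) ∪ {z̃}; (ii) P_{G̃(z)}(z) = {z̃}; (iii) z̃ ∉ closedBall(z, σ); (iv) H(G̃(x), G̃(y)) ≤ (L/3 + 2/3)‖x−y‖ for all x,y ∈ C, in particular G̃ is a strict contraction; (v) sup_{x∈C}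 H(G(x), G̃(x)) < σ; (vi) for every x̃ ∈ B(z, ε'/3) one has P_{G̃(z)}(x̃) = {z̃}. -/
open Metric Set

lemma soft_aux_s11 {X : Type*} [NormedAddCommGroup X] [NormedSpace ℝ X] (u v : X) (ρ : ℝ) (hρ : 0 < ρ)
    (hv : ρ < ‖v‖) (huv : ‖v‖ ≤ ‖u‖) :
    ‖(1 - ρ / ‖u‖) • u - (1 - ρ / ‖v‖) • v‖ ≤ ‖u - v‖ := by
  have hv0 : 0 < ‖v‖ := hρ.trans hv
  have hu0 : 0 < ‖u‖ := hv0.trans_le huv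
  have e : (1 - ρ / ‖u‖) • u - (1 - ρ / ‖v‖) • v
      = (1 - ρ / ‖u‖) • (u - v) + (ρ / ‖v‖ - ρ / ‖u‖) • v := by module
  have h1 : 0 ≤ 1 - ρ / ‖u‖ := by
    rw [sub_nonneg, div_le_one hu0]; linarith
  have h2 : 0 ≤ ρ / ‖v‖ - ρ / ‖u‖ := by
    rw [sub_nonneg]; gcongr
  have h3 : ‖u‖ - ‖v‖ ≤ ‖u - v‖ := norm_sub_norm_le u v
  have h4 : (ρ / ‖v‖ - ρ / ‖u‖) * ‖v‖ = ρ / ‖u‖ * (‖u‖ - ‖v‖) := by field_simp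
  have h5 : ρ / ‖u‖ * (‖u‖ - ‖v‖) ≤ ρ / ‖u‖ * ‖u - v‖ := by gcongr
  rw [e]
  refine (norm_add_le _ _).trans ?_
  rw [norm_smul, norm_smul, Real.norm_of_nonneg h1, Real.norm_of_nonneg h2, h4]
  linarith

lemma soft_lip {X : Type*} [NormedAddCommGroup X] [NormedSpace ℝ X] (u v : X) (ρ : ℝ) (hρ : 0 < ρ)
    (hv : ρ < ‖v‖) (hu : ρ < ‖u‖) :
    ‖(1 - ρ / ‖u‖) • u - (1 - ρ / ‖v‖) • v‖ ≤ ‖u - v‖ := by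
  rcases le_total ‖v‖ ‖u‖ with h | h
  · exact soft_aux_s11 u v ρ hρ hv h
  · rw [norm_sub_rev, norm_sub_rev u v]
    exact soft_aux_s11 v u ρ hρ hu h

lemma haus_union {X : Type*} [NormedAddCommGroup X] (A : Set X) (a b : X) :
    hausdorffDist (A ∪ {a}) (A ∪ {b}) ≤ dist a b := by
  refine hausdorffDist_le_of_mem_dist dist_nonneg ?_ ?_
  · rintro x (hx | hx)
    · exact ⟨x, Or.inl hx, by simp⟩
    · rw [mem_singleton_iff] at hx
      exact ⟨b, Or.inr rfl, by rw [hx]⟩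
  · rintro x (hx | hx)
    · exact ⟨x, Or.inl hx, by simp⟩
    · rw [mem_singleton_iff] at hx
      exact ⟨a, Or.inr rfl, by rw [hx, dist_comm]⟩

/-- Let `G : C → 𝒦(C)` be an `L`-contraction (`L < 1`), `z ∈ C` with
`z ∉ G(z)`, `δ = dist(z,G(z))`, `σ ∈ (0,δ/2)`, `ε' = (1−L)σ/4`. Then there are
`G̃ : C → 𝒦(C)` and `z̃ ∈ C \ G(z)` with:
(i) `G̃(z) = G(z) ∪ {z̃}`; (ii) `P_{G̃(z)}(z) = {z̃}`; (iii) `z̃ ∉ closedBall(z,σ)`;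
(iv) `H(G̃(x),G̃(y)) ≤ (L/3 + 2/3)‖x−y‖` (a strict contraction);
(v) `sup_{x∈C} H(G(x),G̃(x)) < σ`; (vi) `P_{G̃(z)}(x̃) = {z̃}` for all `x̃ ∈ B(z,ε'/3)`. -/
theorem construction_G_tilde
    {X : Type*} [NormedAddCommGroup X] [NormedSpace ℝ X] [CompleteSpace X]
    (C : Set X) (hCne : C.Nonempty) (hCcl : IsClosed C)
    (hCbd : Bornology.IsBounded C) (hCcv : Convex ℝ C)
    (G : X → Set X)
    (hGK : ∀ x ∈ C, (G x).Nonempty ∧ IsCompact (G x) ∧ G x ⊆ C)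
    (L : ℝ) (hL0 : 0 ≤ L) (hL1 : L < 1)
    (hG : ∀ x ∈ C, ∀ y ∈ C, hausdorffDist (G x) (G y) ≤ L * dist x y)
    (z : X) (hz : z ∈ C) (hzG : z ∉ G z)
    (δ : ℝ) (hδ : δ = infDist z (G z))
    (σ : ℝ) (hσ : σ ∈ Set.Ioo (0 : ℝ) (δ / 2))
    (ε' : ℝ) (hε' : ε' = (1 - L) * σ / 4) :
    ∃ Gt : X → Set X, ∃ zt ∈ C \ G z,
      (∀ x ∈ C, (Gt x).Nonempty ∧ IsCompact (Gt x) ∧ Gt x ⊆ C) ∧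
      Gt z = G z ∪ {zt} ∧
      projSet (Gt z) z = {zt} ∧
      zt ∉ closedBall z σ ∧
      (∀ x ∈ C, ∀ y ∈ C, hausdorffDist (Gt x) (Gt y) ≤ (L / 3 + 2 / 3) * ‖x - y‖) ∧
      (∃ σ' < σ, ∀ x ∈ C, hausdorffDist (G x) (Gt x) ≤ σ') ∧
      ∀ xt ∈ ball z (ε' / 3) ∩ C, projSet (Gt z) xt = {zt} := by
  classical
  obtain ⟨hσ0, hσ1⟩ := hσ
  obtain ⟨hGne, hGc, hGC⟩ := hGK z hz
  obtain ⟨p, hp, hpd⟩ := hGc.exists_infDist_eq_dist hGne z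
  have hδ0 : 0 < δ := by linarith
  have hε0 : 0 < ε' := by
    rw [hε']; have : 0 < (1 - L) * σ := mul_pos (by linarith) hσ0
    linarith
  have hε1 : ε' ≤ σ / 4 := by rw [hε']; nlinarith
  have hzp : ‖z - p‖ = δ := by rw [hδ, hpd, dist_eq_norm]
  let w : X → X := fun x => p + (2 / 3 * (ε' - ‖x - z‖) / δ) • (z - p)
  let φ : X → X := fun x => z + (1 - ε' / ‖x - z‖) • (x - z)
  have hww : ∀ x y, dist (w x) (w y) ≤ 2 / 3 * ‖x - y‖ := by
    intro x y
    have e : w x - w y = (2 / 3 * (‖y - z‖ - ‖x - z‖) / δ) • (z - p) := by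
      simp only [w]
      rw [add_sub_add_left_eq_sub, ← sub_smul]
      congr 1
      ring
    have h1 := abs_norm_sub_norm_le (y - z) (x - z)
    rw [sub_sub_sub_cancel_right, norm_sub_rev y x] at h1
    rw [dist_eq_norm, e, norm_smul, hzp, Real.norm_eq_abs, abs_div, abs_mul, abs_of_pos hδ0,
      div_mul_cancel₀ _ hδ0.ne', abs_of_pos (by norm_num : (0 : ℝ) < 2 / 3)]
    linarith
  have hwp : ∀ x, ‖x - z‖ ≤ ε' → dist (w x) p = 2 / 3 * (ε' - ‖x - z‖) := by
    intro x hx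
    have h0 : 0 ≤ 2 / 3 * (ε' - ‖x - z‖) / δ := div_nonneg (by linarith) hδ0.le
    simp only [w]
    rw [dist_eq_norm, add_sub_cancel_left, norm_smul, hzp, Real.norm_of_nonneg h0,
      div_mul_cancel₀ _ hδ0.ne']
  have hwC : ∀ x, ‖x - z‖ ≤ ε' → w x ∈ C := by
    intro x hx
    have h0 : 0 ≤ 2 / 3 * (ε' - ‖x - z‖) / δ := div_nonneg (by linarith) hδ0.le
    have h1 : 2 / 3 * (ε' - ‖x - z‖) / δ ≤ 1 := by
      rw [div_le_one hδ0]; have := norm_nonneg (x - z); linarith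
    exact hCcv.add_smul_sub_mem (hGC hp) hz ⟨h0, h1⟩
  have hφC : ∀ x ∈ C, ε' < ‖x - z‖ → φ x ∈ C := by
    intro x hx hd
    have hd0 := hε0.trans hd
    have h1 : ε' / ‖x - z‖ ≤ 1 := by rw [div_le_one hd0]; exact hd.le
    have h2 : 0 ≤ ε' / ‖x - z‖ := by positivity
    exact hCcv.add_smul_sub_mem hz hx ⟨by linarith, by linarith⟩
  have hφz : ∀ x, ε' < ‖x - z‖ → dist (φ x) z = ‖x - z‖ - ε' := by
    intro x hd
    have hd0 := hε0.trans hd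
    have h1 : ε' / ‖x - z‖ ≤ 1 := by rw [div_le_one hd0]; exact hd.le
    simp only [φ]
    rw [dist_eq_norm, add_sub_cancel_left, norm_smul, Real.norm_of_nonneg (by linarith)]
    field_simp
  have hφx : ∀ x, ε' < ‖x - z‖ → dist x (φ x) = ε' := by
    intro x hd
    have hd0 := hε0.trans hd
    have e : x - φ x = (ε' / ‖x - z‖) • (x - z) := by simp only [φ]; module
    rw [dist_eq_norm, e, norm_smul, Real.norm_of_nonneg (by positivity)]
    field_simp
  have hφφ : ∀ x y, ε' < ‖x - z‖ → ε' < ‖y - z‖ → dist (φ x) (φ y) ≤ ‖x - y‖ := by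
    intro x y hx hy
    have := soft_lip (x - z) (y - z) ε' hε0 hy hx
    rw [sub_sub_sub_cancel_right] at this
    simpa only [φ, dist_eq_norm, add_sub_add_left_eq_sub] using this
  let Gt : X → Set X := fun x => if ‖x - z‖ ≤ ε' then G z ∪ {w x} else G (φ x)
  have Gt1 : ∀ x, ‖x - z‖ ≤ ε' → Gt x = G z ∪ {w x} := fun x hx => if_pos hx
  have Gt2 : ∀ x, ε' < ‖x - z‖ → Gt x = G (φ x) := fun x hx => if_neg (not_le.2 hx)
  have hK : ∀ x ∈ C, (Gt x).Nonempty ∧ IsCompact (Gt x) ∧ Gt x ⊆ C := by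
    intro x hx
    rcases le_or_gt ‖x - z‖ ε' with h | h
    · rw [Gt1 x h]
      exact ⟨hGne.inl, hGc.union isCompact_singleton,
        union_subset hGC (singleton_subset_iff.2 (hwC x h))⟩
    · rw [Gt2 x h]
      exact hGK _ (hφC x hx h)
  have hGw : ∀ x, ‖x - z‖ ≤ ε' → hausdorffDist (G z) (Gt x) ≤ 2 / 3 * (ε' - ‖x - z‖) := by
    intro x hx
    have := haus_union (G z) p (w x)
    rw [dist_comm, hwp x hx, union_singleton, insert_eq_of_mem hp] at this
    rwa [Gt1 x hx]
  have hfin : ∀ A B : Set X, (A.Nonempty ∧ IsCompact A ∧ A ⊆ C) →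
      (B.Nonempty ∧ IsCompact B ∧ B ⊆ C) → hausdorffEDist A B ≠ ⊤ := by
    intro A B hA hB
    exact hausdorffEDist_ne_top_of_nonempty_of_bounded hA.1 hB.1 hA.2.1.isBounded hB.2.1.isBounded
  have hmix : ∀ x ∈ C, ∀ y ∈ C, ‖x - z‖ ≤ ε' → ε' < ‖y - z‖ →
      hausdorffDist (Gt x) (Gt y) ≤ (L / 3 + 2 / 3) * ‖x - y‖ := by
    intro x hx y hy hdx hdy
    have h1 := hGw x hdx
    rw [hausdorffDist_comm] at h1
    have h2 := hG z hz (φ y) (hφC y hy hdy)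
    rw [dist_comm, hφz y hdy, ← Gt2 y hdy] at h2
    have h3 := hausdorffDist_triangle (u := Gt y) (hfin _ _ (hK x hx) (hGK z hz))
    have h4 := norm_sub_norm_le (y - z) (x - z)
    rw [sub_sub_sub_cancel_right, norm_sub_rev y x] at h4
    have h5 : L * (‖y - z‖ - ε') ≤ (L / 3 + 2 / 3) * (‖y - z‖ - ε') :=
      mul_le_mul_of_nonneg_right (by linarith) (by linarith)
    have h6 : 2 / 3 * (ε' - ‖x - z‖) ≤ (L / 3 + 2 / 3) * (ε' - ‖x - z‖) :=
      mul_le_mul_of_nonneg_right (by linarith) (by linarith)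
    have h7 : (L / 3 + 2 / 3) * (‖y - z‖ - ‖x - z‖) ≤ (L / 3 + 2 / 3) * ‖x - y‖ :=
      mul_le_mul_of_nonneg_left h4 (by linarith)
    linarith
  have hzz : ‖z - z‖ ≤ ε' := by simpa using hε0.le
  have hzw : dist z (w z) = δ - 2 / 3 * ε' := by
    have e : z - w z = (1 - 2 / 3 * ε' / δ) • (z - p) := by
      simp only [w, sub_self, norm_zero, sub_zero]; module
    have h1 : 2 / 3 * ε' / δ ≤ 1 := by rw [div_le_one hδ0]; linarith
    rw [dist_eq_norm, e, norm_smul, hzp, Real.norm_of_nonneg (by linarith)]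
    field_simp
  have hq : ∀ q ∈ G z, δ ≤ dist z q := fun q hq => hδ ▸ infDist_le_dist_of_mem hq
  have hproj : ∀ xt ∈ ball z (ε' / 3), projSet (Gt z) xt = {w z} := by
    intro xt hxt
    rw [mem_ball] at hxt
    rw [Gt1 z hzz]
    have hlt : ∀ q ∈ G z, dist xt (w z) < dist xt q := by
      intro q hq'
      have h1 := hq q hq'
      have h2 := dist_triangle xt z (w z)
      have h3 := dist_triangle z xt q
      rw [dist_comm z xt] at h3
      linarith
    have hmem : w z ∈ G z ∪ {w z} := Or.inr rfl
    have hinf : infDist xt (G z ∪ {w z}) = dist xt (w z) := by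
      apply le_antisymm (infDist_le_dist_of_mem hmem)
      rw [le_infDist ⟨_, hmem⟩]
      rintro q (hq' | hq')
      · exact (hlt q hq').le
      · rw [mem_singleton_iff] at hq'
        rw [hq']
    ext y
    simp only [projSet, mem_setOf_eq, mem_singleton_iff, hinf]
    constructor
    · rintro ⟨hy | hy, hd⟩
      · exact absurd hd (hlt y hy).ne'
      · exact hy
    · rintro rfl
      exact ⟨hmem, rfl⟩
  refine ⟨Gt, w z, ⟨hwC z hzz, fun h => ?_⟩, hK, Gt1 z hzz,
    hproj z (mem_ball_self (by linarith)), ?_, ?_, ⟨5 / 3 * ε', by linarith, ?_⟩,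
    fun xt hxt => hproj xt hxt.1⟩
  · have := hq _ h
    linarith
  · rw [mem_closedBall, dist_comm, hzw]
    intro h
    linarith
  · intro x hx y hy
    rcases le_or_gt ‖x - z‖ ε' with h | h <;> rcases le_or_gt ‖y - z‖ ε' with h' | h'
    · rw [Gt1 x h, Gt1 y h']
      have h1 := haus_union (G z) (w x) (w y)
      have h2 := hww x y
      have h3 : 0 ≤ L * ‖x - y‖ := by positivity
      linarith
    · exact hmix x hx y hy h h'
    · rw [hausdorffDist_comm, norm_sub_rev]
      exact hmix y hy x hx h' h
    · rw [Gt2 x h, Gt2 y h']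
      have h1 := hG _ (hφC x hx h) _ (hφC y hy h')
      have h2 := mul_le_mul_of_nonneg_left (hφφ x y h h') hL0
      have h3 : L * ‖x - y‖ ≤ (L / 3 + 2 / 3) * ‖x - y‖ :=
        mul_le_mul_of_nonneg_right (by linarith) (norm_nonneg _)
      linarith
  · intro x hx
    rcases le_or_gt ‖x - z‖ ε' with h | h
    · have h1 := hGw x h
      have h2 := hG x hx z hz
      rw [dist_eq_norm] at h2
      have h3 := hausdorffDist_triangle (u := Gt x) (hfin _ _ (hGK x hx) (hGK z hz))
      have h4 := norm_nonneg (x - z)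
      nlinarith
    · have h2 := hG x hx _ (hφC x hx h)
      rw [hφx x h, ← Gt2 x h] at h2
      nlinarith
end

section
/- Let G : C → 𝒦(C) satisfy H(G(x),G(y)) ≤ L‖x−y‖ for all x,y ∈ C with some L ∈ [0,1), let ζ₀ ∈ C, and let (ζᵢ)_{i≥0} be a trajectory with respect to G, i.e. ζ_{i+1} ∈ P_{G(ζᵢ)}(ζᵢ) for all i. Then dist(ζᵢ, G(ζᵢ)) ≤ Lⁱ · dist(ζ₀, G(ζ₀)) for all i ≥ 0. Moreover, if none of the points ζ₀, …, ζ_m satisfies ζⱼ ∈ G(ζⱼ), then ζᵢ ≠ ζⱼ for all 0 ≤ i < j ≤ m. -/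
open Metric Set

/-- Let `G : C → 𝒦(C)` be an `L`-contraction (`L < 1`) and let
`(ζᵢ)` be a trajectory with respect to `G` (i.e. `ζ_{i+1} ∈ P_{G(ζᵢ)}(ζᵢ)`). Then
`dist(ζᵢ, G(ζᵢ)) ≤ Lⁱ · dist(ζ₀, G(ζ₀))` for all `i`; moreover, if none of
`ζ₀, …, ζ_m` is a fixed point of `G`, then the points `ζ₀, …, ζ_m` are pairwise
distinct. -/
theorem trajectory_never_repeats
    {X : Type*} [NormedAddCommGroup X] [NormedSpace ℝ X] [CompleteSpace X]
    (C : Set X) (hCne : C.Nonempty) (hCcl : IsClosed C)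
    (hCbd : Bornology.IsBounded C) (hCcv : Convex ℝ C)
    (G : X → Set X)
    (hGK : ∀ x ∈ C, (G x).Nonempty ∧ IsCompact (G x) ∧ G x ⊆ C)
    (L : ℝ) (hL0 : 0 ≤ L) (hL1 : L < 1)
    (hG : ∀ x ∈ C, ∀ y ∈ C, hausdorffDist (G x) (G y) ≤ L * dist x y)
    (ζ : ℕ → X) (hζ0 : ζ 0 ∈ C)
    (htraj : ∀ i : ℕ, ζ (i + 1) ∈ projSet (G (ζ i)) (ζ i)) :
    (∀ i : ℕ, infDist (ζ i) (G (ζ i)) ≤ L ^ i * infDist (ζ 0) (G (ζ 0))) ∧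
    ∀ m : ℕ, (∀ j ≤ m, ζ j ∉ G (ζ j)) → ∀ i < m + 1, ∀ j < m + 1, i ≠ j → ζ i ≠ ζ j := by
  have hC : ∀ i, ζ i ∈ C := by
    intro i
    induction i with
    | zero => exact hζ0
    | succ k ih => exact (hGK _ ih).2.2 (htraj k).1
  have hstep : ∀ i, infDist (ζ (i + 1)) (G (ζ (i + 1))) ≤ L * infDist (ζ i) (G (ζ i)) := by
    intro i
    have h1 := hGK _ (hC i)
    have h2 := hGK _ (hC (i + 1))
    have hfin : hausdorffEDist (G (ζ i)) (G (ζ (i + 1))) ≠ ⊤ :=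
      hausdorffEDist_ne_top_of_nonempty_of_bounded h1.1 h2.1 h1.2.1.isBounded h2.2.1.isBounded
    have h3 := infDist_le_hausdorffDist_of_mem (htraj i).1 hfin
    have h4 := hG _ (hC i) _ (hC (i + 1))
    rw [(htraj i).2] at h4
    exact h3.trans h4
  have hpow : ∀ i k, infDist (ζ (i + k)) (G (ζ (i + k))) ≤ L ^ k * infDist (ζ i) (G (ζ i)) := by
    intro i k
    induction k with
    | zero => simp
    | succ k ih =>
      calc _ ≤ L * infDist (ζ (i + k)) (G (ζ (i + k))) := hstep (i + k)
        _ ≤ L * (L ^ k * infDist (ζ i) (G (ζ i))) := mul_le_mul_of_nonneg_left ih hL0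
        _ = _ := by ring
  refine ⟨fun i => by simpa using hpow 0 i, ?_⟩
  intro m hm
  have key : ∀ i j, i < j → j ≤ m → ζ i ≠ ζ j := by
    intro i j hij hj heq
    obtain ⟨k, rfl⟩ := Nat.exists_eq_add_of_lt hij
    have h := hpow i (k + 1)
    rw [← add_assoc, ← heq] at h
    have hi := hGK _ (hC i)
    have hpos : 0 < infDist (ζ i) (G (ζ i)) :=
      (hi.2.1.isClosed.notMem_iff_infDist_pos hi.1).1 (hm i (by omega))
    have hlt : L ^ (k + 1) < 1 := pow_lt_one₀ hL0 hL1 (Nat.succ_ne_zero k)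
    nlinarith
  intro i hi j hj hne
  rcases lt_or_gt_of_ne hne with h | h
  · exact key i j h (by omega)
  · exact (key j i h (by omega)).symm
end

section
/- Let F : C → 𝒦(C) be a strict contraction, x₀ ∈ C with x₀ ∉ F(x₀), n ∈ ℕ and r > 0. Then there exist a nonexpansive map G : C → 𝒦(C) with sup_{x∈C} H(F(x), G(x)) < r and points x₁, …, x_n ∈ C such that P_{G(x_k)}(x_k) = {x_{k+1}} for all 0 ≤ k ≤ n−1; that is, the trajectory with respect to G starting at x₀ is unique in the first n steps. -/
open Metric Set

lemma aux_step {X : Type*} [NormedAddCommGroup X] [NormedSpace ℝ X]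
    (C : Set X) (hCcv : Convex ℝ C) (D : ℝ) (hD : 0 < D)
    (hCD : ∀ a ∈ C, ∀ b ∈ C, dist a b ≤ D)
    (F : X → Set X)
    (hFK : ∀ x ∈ C, (F x).Nonempty ∧ IsCompact (F x) ∧ F x ⊆ C)
    (L : ℝ) (hL0 : 0 ≤ L) (hL1 : L < 1)
    (hF : ∀ x ∈ C, ∀ y ∈ C, hausdorffDist (F x) (F y) ≤ L * dist x y)
    (p : X) (hp : p ∈ C) (δ : ℝ) (hδ : 0 < δ) (r : ℝ) (hr : 0 < r) :
    ∃ G : X → Set X, ∃ q ∈ C, ∃ L' : ℝ, 0 ≤ L' ∧ L' < 1 ∧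
      (∀ y ∈ C, (G y).Nonempty ∧ IsCompact (G y) ∧ G y ⊆ C) ∧
      (∀ y ∈ C, ∀ y' ∈ C, hausdorffDist (G y) (G y') ≤ L' * dist y y') ∧
      (∀ y ∈ C, hausdorffDist (F y) (G y) ≤ r) ∧
      (∀ y, δ ≤ dist y p → G y = F y) ∧
      projSet (G p) p = {q} := by
  obtain ⟨c, hc, hcD⟩ : ∃ c : ℝ, 0 < c ∧ c * D = (1 - L) / 4 :=
    ⟨(1 - L) / 4 / D, by have : 0 < 1 - L := by linarith
                         positivity, by field_simp⟩
  obtain ⟨s, hs, hs1, hsD, hsδ⟩ : ∃ s : ℝ, 0 < s ∧ s ≤ 1 / 2 ∧ s * D ≤ r ∧ s ≤ c * δ := by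
    refine ⟨min (1 / 2) (min (r / D) (c * δ)), by positivity, min_le_left _ _, ?_, ?_⟩
    · rw [← le_div_iff₀ hD]
      exact (min_le_right _ _).trans (min_le_left _ _)
    · exact (min_le_right _ _).trans (min_le_right _ _)
  obtain ⟨hne, hcp, hsub⟩ := hFK p hp
  obtain ⟨y, hyF, hyd⟩ := hcp.exists_infDist_eq_dist hne p
  have hyC := hsub hyF
  have hymin : ∀ a ∈ F p, dist p y ≤ dist p a := fun a ha => hyd ▸ infDist_le_dist_of_mem ha
  set lam : X → X → ℝ := fun x a => max 0 (s - c * dist x p - c * dist a y) with hlam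
  have lam0 : ∀ x a, 0 ≤ lam x a := fun x a => le_max_left _ _
  have lams : ∀ x a, lam x a ≤ s := fun x a => by
    refine max_le hs.le ?_
    have := mul_nonneg hc.le (dist_nonneg (x := x) (y := p))
    have := mul_nonneg hc.le (dist_nonneg (x := a) (y := y))
    linarith
  have lamL : ∀ x a x' a', |lam x a - lam x' a'| ≤ c * dist x x' + c * dist a a' := by
    intro x a x' a'
    refine (abs_max_sub_max_le_max _ _ _ _).trans ?_
    refine max_le (by rw [sub_self, abs_zero]; positivity) ?_
    have h1 := abs_dist_sub_le x x' p
    have h2 := abs_dist_sub_le a a' y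
    rw [abs_le] at h1 h2 ⊢
    constructor <;> nlinarith
  set T : X → X → X := fun x a => a + lam x a • (p - a) with hT
  have TC : ∀ x, ∀ a ∈ C, T x a ∈ C := by
    intro x a ha
    exact hCcv.add_smul_sub_mem ha hp ⟨lam0 x a, by linarith [lams x a]⟩
  have TL : ∀ x, ∀ a ∈ C, ∀ x', ∀ a' ∈ C,
      dist (T x a) (T x' a') ≤ (1 + c * D) * dist a a' + c * D * dist x x' := by
    intro x a ha x' a' ha'
    have e : T x a - T x' a' = (1 - lam x a) • (a - a') + (lam x a - lam x' a') • (p - a') := by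
      simp only [hT]; module
    rw [dist_eq_norm, e]
    refine (norm_add_le _ _).trans ?_
    rw [norm_smul, norm_smul, Real.norm_eq_abs, Real.norm_eq_abs, ← dist_eq_norm, ← dist_eq_norm,
      abs_of_nonneg (by linarith [lams x a])]
    have h1 : (1 - lam x a) * dist a a' ≤ 1 * dist a a' :=
      mul_le_mul_of_nonneg_right (by linarith [lam0 x a]) dist_nonneg
    have h2 : |lam x a - lam x' a'| * dist p a' ≤ (c * dist x x' + c * dist a a') * D :=
      mul_le_mul (lamL x a x' a') (hCD p hp a' ha') dist_nonneg (by positivity)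
    linarith
  have Tcl : ∀ x, ∀ a ∈ C, dist a (T x a) ≤ r := by
    intro x a ha
    simp only [hT, dist_self_add_right, norm_smul, Real.norm_eq_abs, abs_of_nonneg (lam0 x a)]
    rw [← dist_eq_norm]
    exact (mul_le_mul (lams x a) (hCD p hp a ha) dist_nonneg hs.le).trans hsD
  have Tp : ∀ a, dist p (T p a) = (1 - lam p a) * dist p a := by
    intro a
    have e : p - T p a = (1 - lam p a) • (p - a) := by simp only [hT]; module
    rw [dist_eq_norm, e, norm_smul, Real.norm_eq_abs, abs_of_nonneg (by linarith [lams p a]),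
      dist_eq_norm]
  have lamy : lam p y = s := by simp [hlam, hs.le]
  have lamlt : ∀ a, a ≠ y → lam p a < s := by
    intro a ha
    have := mul_pos hc (dist_pos.2 ha)
    simp only [hlam, dist_self]
    exact max_lt hs (by linarith)
  have Tlt : ∀ a ∈ F p, a ≠ y → dist p (T p y) < dist p (T p a) := by
    intro a ha hay
    rw [Tp, Tp, lamy]
    have h1 := lamlt a hay
    have h2 := hymin a ha
    rcases (dist_nonneg (x := p) (y := y)).eq_or_lt with h0 | h0
    · have hpy : p = y := dist_eq_zero.1 h0.symm
      rw [← h0, mul_zero]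
      exact mul_pos (by linarith) (dist_pos.2 (fun h => hay (h ▸ hpy)))
    · nlinarith
  have hmem : ∀ x ∈ C, ∀ x' ∈ C, ∀ a ∈ F x, ∃ a' ∈ F x', dist a a' ≤ L * dist x x' := by
    intro x hx x' hx' a ha
    obtain ⟨h1, h2, h3⟩ := hFK x hx
    obtain ⟨h1', h2', h3'⟩ := hFK x' hx'
    obtain ⟨a', ha', e⟩ := h2'.exists_infDist_eq_dist h1' a
    refine ⟨a', ha', ?_⟩
    rw [← e]
    exact (infDist_le_hausdorffDist_of_mem ha
      (hausdorffEDist_ne_top_of_nonempty_of_bounded h1 h1' h2.isBounded h2'.isBounded)).trans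
      (hF x hx x' hx')
  have key : ∀ x ∈ C, ∀ x' ∈ C, ∀ b ∈ T x '' F x, ∃ b' ∈ T x' '' F x',
      dist b b' ≤ (1 + L) / 2 * dist x x' := by
    rintro x hx x' hx' _ ⟨a, ha, rfl⟩
    obtain ⟨a', ha', h⟩ := hmem x hx x' hx' a ha
    refine ⟨_, ⟨a', ha', rfl⟩, (TL x a ((hFK x hx).2.2 ha) x' a' ((hFK x' hx').2.2 ha')).trans ?_⟩
    rw [hcD]
    have h3 : (1 + (1 - L) / 4) * dist a a' ≤ (1 + (1 - L) / 4) * (L * dist x x') :=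
      mul_le_mul_of_nonneg_left h (by linarith)
    have h4 : (1 + (1 - L) / 4) * L + (1 - L) / 4 ≤ (1 + L) / 2 := by nlinarith
    nlinarith [mul_le_mul_of_nonneg_right h4 (dist_nonneg (x := x) (y := x'))]
  refine ⟨fun x => T x '' F x, T p y, TC p y hyC, (1 + L) / 2, by linarith, by linarith,
    ?_, ?_, ?_, ?_, ?_⟩
  · intro x hx
    obtain ⟨h1, h2, h3⟩ := hFK x hx
    refine ⟨h1.image _, h2.image ?_, ?_⟩
    · simp only [hT, hlam]
      fun_prop
    · rintro _ ⟨a, ha, rfl⟩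
      exact TC x a (h3 ha)
  · intro x hx x' hx'
    refine hausdorffDist_le_of_mem_dist (mul_nonneg (by linarith) dist_nonneg)
      (key x hx x' hx') ?_
    rw [dist_comm]
    exact key x' hx' x hx
  · intro x hx
    refine hausdorffDist_le_of_mem_dist hr.le ?_ ?_
    · intro a ha
      exact ⟨_, ⟨a, ha, rfl⟩, Tcl x a ((hFK x hx).2.2 ha)⟩
    · rintro _ ⟨a, ha, rfl⟩
      exact ⟨a, ha, by rw [dist_comm]; exact Tcl x a ((hFK x hx).2.2 ha)⟩
  · intro x hx
    have : ∀ a, T x a = a := by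
      intro a
      have : lam x a = 0 := by
        refine max_eq_left ?_
        have := mul_le_mul_of_nonneg_left hx hc.le
        have := mul_nonneg hc.le (dist_nonneg (x := a) (y := y))
        linarith
      simp [hT, this]
    simp [this]
  · have hle : ∀ a ∈ F p, dist p (T p y) ≤ dist p (T p a) := by
      intro a ha
      by_cases h : a = y
      · rw [h]
      · exact (Tlt a ha h).le
    have hinf : infDist p (T p '' F p) = dist p (T p y) := by
      refine le_antisymm (infDist_le_dist_of_mem ⟨y, hyF, rfl⟩) ?_
      rw [le_infDist (hne.image _)]
      rintro _ ⟨a, ha, rfl⟩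
      exact hle a ha
    ext b
    simp only [projSet, mem_setOf_eq, mem_singleton_iff, hinf]
    constructor
    · rintro ⟨⟨a, ha, rfl⟩, h⟩
      by_contra hne'
      have hay : a ≠ y := fun h => hne' (by rw [h])
      exact absurd h (Tlt a ha hay).ne'
    · rintro rfl
      exact ⟨⟨y, hyF, rfl⟩, rfl⟩

lemma aux_sep {X : Type*} [MetricSpace X] (x : ℕ → X) (p : X) (k : ℕ)
    (h : ∀ j < k, x j ≠ p) : ∃ δ > 0, ∀ j < k, δ ≤ dist (x j) p := by
  induction k with
  | zero => exact ⟨1, one_pos, by simp⟩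
  | succ k ih =>
    obtain ⟨δ, h0, h1⟩ := ih fun j hj => h j (by omega)
    refine ⟨min δ (dist (x k) p), lt_min h0 (dist_pos.2 (h k (by omega))), fun j hj => ?_⟩
    rcases Nat.lt_succ_iff_lt_or_eq.1 hj with hj | rfl
    · exact (min_le_left _ _).trans (h1 j hj)
    · exact min_le_right _ _

lemma aux_main {X : Type*} [NormedAddCommGroup X] [NormedSpace ℝ X]
    (C : Set X) (hCcv : Convex ℝ C) (D : ℝ) (hD : 0 < D)
    (hCD : ∀ a ∈ C, ∀ b ∈ C, dist a b ≤ D)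
    (F : X → Set X)
    (hFK : ∀ x ∈ C, (F x).Nonempty ∧ IsCompact (F x) ∧ F x ⊆ C)
    (L : ℝ) (hL0 : 0 ≤ L) (hL1 : L < 1)
    (hF : ∀ x ∈ C, ∀ y ∈ C, hausdorffDist (F x) (F y) ≤ L * dist x y)
    (x₀ : X) (hx₀ : x₀ ∈ C) (n : ℕ) :
    ∀ r : ℝ, 0 < r →
    ∃ G : X → Set X, ∃ x : ℕ → X, ∃ L' : ℝ, 0 ≤ L' ∧ L' < 1 ∧
      (∀ y ∈ C, (G y).Nonempty ∧ IsCompact (G y) ∧ G y ⊆ C) ∧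
      (∀ y ∈ C, ∀ y' ∈ C, hausdorffDist (G y) (G y') ≤ L' * dist y y') ∧
      (∀ y ∈ C, hausdorffDist (F y) (G y) ≤ r) ∧
      x 0 = x₀ ∧ (∀ k ≤ n, x k ∈ C) ∧
      ∀ k < n, projSet (G (x k)) (x k) = {x (k + 1)} := by
  induction n with
  | zero =>
    intro r hr
    refine ⟨F, fun _ => x₀, L, hL0, hL1, hFK, hF, ?_, rfl, fun _ _ => hx₀, by simp⟩
    intro y _
    rw [hausdorffDist_self_zero]
    exact hr.le
  | succ n ih =>
    intro r hr
    obtain ⟨G, x, L', h0, h1, hK, hG, hFG, hx0, hxC, hP⟩ := ih (r / 2) (by positivity)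
    have upd : ∀ q : X, ∀ j ≤ n, Function.update x (n + 1) q j = x j := fun q j hj =>
      Function.update_of_ne (by omega) _ _
    by_cases hrep : ∃ j < n, x j = x n
    · obtain ⟨j, hj, hjn⟩ := hrep
      refine ⟨G, Function.update x (n + 1) (x (j + 1)), L', h0, h1, hK, hG,
        fun y hy => (hFG y hy).trans (by linarith), by rw [upd _ 0 (by omega), hx0], ?_, ?_⟩
      · intro k hk
        rcases Nat.le_succ_iff.1 hk with hk | rfl
        · rw [upd _ k hk]; exact hxC k hk
        · simpa using hxC _ (by omega)
      · intro k hk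
        rcases Nat.lt_succ_iff_lt_or_eq.1 hk with hk | rfl
        · rw [upd _ k hk.le, upd _ (k + 1) hk]; exact hP k hk
        · rw [upd _ k le_rfl, Function.update_self, ← hjn]; exact hP j hj
    · push Not at hrep
      obtain ⟨δ, hδ, hsep⟩ := aux_sep x (x n) n hrep
      obtain ⟨G', q, hq, L'', h0', h1', hK', hG', hGG', heq, hproj⟩ :=
        aux_step C hCcv D hD hCD G hK L' h0 h1 hG (x n) (hxC n le_rfl) δ hδ (r / 2) (by positivity)
      refine ⟨G', Function.update x (n + 1) q, L'', h0', h1', hK', hG', ?_,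
        by rw [upd _ 0 (by omega), hx0], ?_, ?_⟩
      · intro y hy
        obtain ⟨a1, a2, a3⟩ := hFK y hy
        obtain ⟨b1, b2, b3⟩ := hK y hy
        have := hausdorffDist_triangle (u := G' y)
          (hausdorffEDist_ne_top_of_nonempty_of_bounded a1 b1 a2.isBounded b2.isBounded)
        linarith [hFG y hy, hGG' y hy]
      · intro k hk
        rcases Nat.le_succ_iff.1 hk with hk | rfl
        · rw [upd _ k hk]; exact hxC k hk
        · simpa using hq
      · intro k hk
        rcases Nat.lt_succ_iff_lt_or_eq.1 hk with hk | rfl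
        · rw [upd _ k hk.le, upd _ (k + 1) hk, heq _ (hsep k hk)]; exact hP k hk
        · rw [upd _ k le_rfl, Function.update_self]; exact hproj

/-- **Claim 1.** Let `F : C → 𝒦(C)` be a strict contraction, `x₀ ∈ C`
with `x₀ ∉ F(x₀)`, `n ∈ ℕ`, `r > 0`. Then there are a nonexpansive `G : C → 𝒦(C)`
with `sup_{x∈C} H(F(x),G(x)) < r` and points `x₁, …, x_n ∈ C` such that
`P_{G(x_k)}(x_k) = {x_{k+1}}` for `0 ≤ k ≤ n−1`: the trajectory w.r.t. `G` starting
at `x₀` is unique in the first `n` steps. -/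
theorem unique_trajectory_first_n_steps
    {X : Type*} [NormedAddCommGroup X] [NormedSpace ℝ X] [CompleteSpace X]
    (C : Set X) (hCne : C.Nonempty) (hCcl : IsClosed C)
    (hCbd : Bornology.IsBounded C) (hCcv : Convex ℝ C)
    (F : X → Set X)
    (hFK : ∀ x ∈ C, (F x).Nonempty ∧ IsCompact (F x) ∧ F x ⊆ C)
    (L : ℝ) (hL0 : 0 ≤ L) (hL1 : L < 1)
    (hF : ∀ x ∈ C, ∀ y ∈ C, hausdorffDist (F x) (F y) ≤ L * dist x y)
    (x₀ : X) (hx₀ : x₀ ∈ C) (hx₀F : x₀ ∉ F x₀)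
    (n : ℕ) (r : ℝ) (hr : 0 < r) :
    ∃ G : X → Set X, ∃ x : ℕ → X,
      (∀ y ∈ C, (G y).Nonempty ∧ IsCompact (G y) ∧ G y ⊆ C) ∧
      (∀ y ∈ C, ∀ y' ∈ C, hausdorffDist (G y) (G y') ≤ dist y y') ∧
      (∃ r' < r, ∀ y ∈ C, hausdorffDist (F y) (G y) ≤ r') ∧
      x 0 = x₀ ∧ (∀ k ≤ n, x k ∈ C) ∧
      ∀ k < n, projSet (G (x k)) (x k) = {x (k + 1)} := by
  obtain ⟨D, hCD⟩ := Metric.isBounded_iff.1 hCbd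
  obtain ⟨G, x, L', h0, h1, hK, hG, hFG, hx0, hxC, hP⟩ :=
    aux_main C hCcv (max D 1) (by positivity)
      (fun a ha b hb => (hCD ha hb).trans (le_max_left _ _)) F hFK L hL0 hL1 hF x₀ hx₀ n
      (r / 2) (by positivity)
  refine ⟨G, x, hK, fun y hy y' hy' => (hG y hy y' hy').trans ?_, ⟨r / 2, by linarith, hFG⟩,
    hx0, hxC, hP⟩
  exact mul_le_of_le_one_left dist_nonneg h1.le
end

section
/- Fix x₀ ∈ C, n ∈ ℕ and β > 0, and define 𝓐_n(x₀) := {F ∈ 𝓜 : ∃ R > 0 such that for every finite trajectory v₀, v₁, …, v_n with respect to F with v₀ ∈ B(x₀,R) and v_k ∈ P_{F(v_{k−1})}(v_{k−1}) for 1 ≤ k ≤ n, one has diam(P_{F(v_k)}(v_k)) ≤ β for all 0 ≤ k ≤ n}. Then 𝓜 \ 𝓐_n(x₀) is nowhere dense in the metric space (𝓜, ρ); equivalently, 𝓐_n(x₀) contains an open and dense subset of 𝓜. -/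
open Metric Set TopologicalSpace BoundedContinuousFunction

/-- The space `𝓜` of nonexpansive compact-set-valued self-mappings of `C`, realized
inside the bounded continuous functions `C →ᵇ 𝒦(X)` (every nonexpansive map on the
bounded set `C` is bounded and continuous); the induced metric is the metric `ρ` of
uniform convergence of the Pompeiu–Hausdorff distances. -/
def MSet {X : Type*} [NormedAddCommGroup X] (C : Set X) :
    Set (C →ᵇ TopologicalSpace.NonemptyCompacts X) :=
  {F | (∀ x : C, (F x : Set X) ⊆ C) ∧ ∀ x y : C, dist (F x) (F y) ≤ dist (x : X) (y : X)}

lemma aux_near {X : Type*} [NormedAddCommGroup X] (A B : NonemptyCompacts X) (p : X)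
    (hp : p ∈ (A : Set X)) : ∃ q ∈ (B : Set X), dist p q ≤ dist A B := by
  obtain ⟨q, hq, h⟩ := B.isCompact.exists_infDist_eq_dist B.nonempty p
  refine ⟨q, hq, ?_⟩
  rw [← h, NonemptyCompacts.dist_eq]
  exact infDist_le_hausdorffDist_of_mem hp
    (hausdorffEDist_ne_top_of_nonempty_of_bounded A.nonempty B.nonempty
      A.isCompact.isBounded B.isCompact.isBounded)

lemma aux_mk {X : Type*} [NormedAddCommGroup X] (C : Set X) (hCbd : Bornology.IsBounded C)
    (G : C → NonemptyCompacts X) (h1 : ∀ x, (G x : Set X) ⊆ C)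
    (h2 : ∀ x y : C, dist (G x) (G y) ≤ dist (x : X) (y : X)) :
    ∃ F : MSet C, ∀ x, F.1 x = G x := by
  have hc : Continuous G := by
    have : LipschitzWith 1 G := LipschitzWith.of_dist_le_mul (by
      intro x y; rw [NNReal.coe_one, one_mul]; exact h2 x y)
    exact this.continuous
  refine ⟨⟨BoundedContinuousFunction.mkOfBound ⟨G, hc⟩ (diam C) ?_, ?_, ?_⟩, ?_⟩
  · intro x y
    exact (h2 x y).trans (dist_le_diam_of_mem hCbd x.2 y.2)
  · exact h1
  · exact h2
  · intro x; rfl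

lemma aux_pert {X : Type*} [NormedAddCommGroup X] (C : Set X) (hCbd : Bornology.IsBounded C)
    (F : MSet C) (c : ℝ) (hF : ∀ x y : C, dist (F.1 x) (F.1 y) ≤ c * dist (x : X) (y : X))
    (Φ : C → X → X) (hΦ : ∀ z, Continuous (Φ z)) (hΦC : ∀ z, ∀ p ∈ C, Φ z p ∈ C)
    (L1 L2 : ℝ) (hL1 : 0 ≤ L1)
    (hL : ∀ z z' : C, ∀ p ∈ C, ∀ p' ∈ C,
      dist (Φ z p) (Φ z' p') ≤ L1 * dist p p' + L2 * dist (z : X) (z' : X))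
    (hc1 : L1 * c + L2 ≤ 1) (e : ℝ) (he : 0 ≤ e) (hΦe : ∀ z, ∀ p ∈ C, dist p (Φ z p) ≤ e) :
    ∃ G : MSet C, (∀ z, (G.1 z : Set X) = Φ z '' (F.1 z : Set X)) ∧
      (∀ x y : C, dist (G.1 x) (G.1 y) ≤ (L1 * c + L2) * dist (x : X) (y : X)) ∧
      dist F G ≤ e := by
  have hFC := F.2.1
  have key : ∀ z z' : C, ∀ p ∈ (F.1 z : Set X), ∃ p' ∈ (F.1 z' : Set X),
      dist (Φ z p) (Φ z' p') ≤ (L1 * c + L2) * dist (z : X) (z' : X) := by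
    intro z z' p hp
    obtain ⟨p', hp', h⟩ := aux_near (F.1 z) (F.1 z') p hp
    refine ⟨p', hp', (hL z z' p (hFC z hp) p' (hFC z' hp')).trans ?_⟩
    have := mul_le_mul_of_nonneg_left (h.trans (hF z z')) hL1
    nlinarith
  have hlip : ∀ x y : C, dist ((F.1 x).map (Φ x) (hΦ x)) ((F.1 y).map (Φ y) (hΦ y))
      ≤ (L1 * c + L2) * dist (x : X) (y : X) := by
    intro x y
    have hnn : 0 ≤ (L1 * c + L2) * dist (x : X) (y : X) := by
      obtain ⟨p, hp⟩ := (F.1 x).nonempty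
      obtain ⟨p', _, h⟩ := key x y p hp
      exact dist_nonneg.trans h
    rw [NonemptyCompacts.dist_eq, NonemptyCompacts.coe_map, NonemptyCompacts.coe_map]
    refine hausdorffDist_le_of_mem_dist hnn ?_ ?_
    · rintro _ ⟨p, hp, rfl⟩
      obtain ⟨p', hp', h⟩ := key x y p hp
      exact ⟨_, ⟨p', hp', rfl⟩, h⟩
    · rintro _ ⟨p, hp, rfl⟩
      obtain ⟨p', hp', h⟩ := key y x p hp
      exact ⟨_, ⟨p', hp', rfl⟩, by rwa [dist_comm (x : X)]⟩
  obtain ⟨G, hG⟩ := aux_mk C hCbd (fun z => (F.1 z).map (Φ z) (hΦ z)) (by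
    intro z
    rw [NonemptyCompacts.coe_map]
    rintro _ ⟨p, hp, rfl⟩
    exact hΦC z p (hFC z hp)) (by
    intro x y
    refine (hlip x y).trans ?_
    nlinarith [dist_nonneg (x := (x : X)) (y := (y : X))])
  refine ⟨G, ?_, ?_, ?_⟩
  · intro z; rw [hG, NonemptyCompacts.coe_map]
  · intro x y; rw [hG, hG]; exact hlip x y
  · rw [Subtype.dist_eq, BoundedContinuousFunction.dist_le he]
    intro z
    rw [hG, NonemptyCompacts.dist_eq, NonemptyCompacts.coe_map]
    refine hausdorffDist_le_of_mem_dist he ?_ ?_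
    · intro p hp
      exact ⟨_, ⟨p, hp, rfl⟩, hΦe z p (hFC z hp)⟩
    · rintro _ ⟨p, hp, rfl⟩
      exact ⟨p, hp, by rw [dist_comm]; exact hΦe z p (hFC z hp)⟩

lemma aux_proj {X : Type*} [NormedAddCommGroup X] (M : Set X) (x y : X) (hy : y ∈ M)
    (h : ∀ q ∈ M, q ≠ y → dist x y < dist x q) : projSet M x = {y} := by
  have hd : infDist x M = dist x y := by
    apply le_antisymm (infDist_le_dist_of_mem hy)
    rw [le_infDist ⟨y, hy⟩]
    intro q hq
    by_cases e : q = y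
    · rw [e]
    · exact (h q hq e).le
  ext q
  simp only [projSet, mem_ofPred_eq, mem_singleton_iff, hd]
  constructor
  · rintro ⟨hq, e⟩
    by_contra hne
    exact absurd e (h q hq hne).ne'
  · rintro rfl
    exact ⟨hy, rfl⟩

lemma aux_robust {X : Type*} [NormedAddCommGroup X] (A : NonemptyCompacts X) (x y : X)
    (h : projSet (A : Set X) x = {y}) (ε : ℝ) (hε : 0 < ε) :
    ∃ δ > 0, ∀ (z : X) (B : NonemptyCompacts X), dist z x < δ → dist B A < δ →
      ∀ q ∈ projSet (B : Set X) z, dist q y < ε := by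
  have hyA : y ∈ projSet (A : Set X) x := by rw [h]; rfl
  obtain ⟨m, hm, hmA⟩ : ∃ m > infDist x (A : Set X), ∀ q ∈ (A : Set X),
      dist x q < m → dist q y < ε / 2 := by
    have hK : IsCompact ((A : Set X) \ ball y (ε / 2)) := A.isCompact.diff isOpen_ball
    rcases ((A : Set X) \ ball y (ε / 2)).eq_empty_or_nonempty with he | hne
    · refine ⟨_, lt_add_one _, fun q hq _ => ?_⟩
      by_contra hc
      have : q ∈ ((A : Set X) \ ball y (ε / 2)) := ⟨hq, hc⟩
      rw [he] at this; exact this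
    · obtain ⟨q0, hq0, hmin⟩ := hK.exists_isMinOn hne
        (f := fun q => dist x q) (by fun_prop)
      refine ⟨dist x q0, ?_, fun q hq hlt => ?_⟩
      · refine lt_of_le_of_ne (infDist_le_dist_of_mem hq0.1) fun e => ?_
        have : q0 ∈ projSet (A : Set X) x := ⟨hq0.1, e.symm⟩
        rw [h] at this
        apply hq0.2
        rw [mem_singleton_iff.1 this]
        exact mem_ball_self (by linarith)
      · by_contra hc
        have := hmin (a := q) ⟨hq, hc⟩
        simp only [mem_ofPred_eq] at this
        linarith
  refine ⟨min ((m - infDist x (A : Set X)) / 4) (ε / 2),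
    lt_min (by linarith) (by linarith), ?_⟩
  intro z B hz hB q hq
  have hz1 := hz.trans_le (min_le_left _ _)
  have hB1 := hB.trans_le (min_le_left _ _)
  have hB2 := hB.trans_le (min_le_right _ _)
  obtain ⟨q', hq', hqq⟩ := aux_near B A q hq.1
  obtain ⟨y', hy', hyy⟩ := aux_near A B y hyA.1
  have e1 : dist z q ≤ dist z y' := by rw [hq.2]; exact infDist_le_dist_of_mem hy'
  have e2 : dist z y' ≤ dist z x + dist x y + dist y y' := dist_triangle4 _ _ _ _
  have e3 : dist x q' ≤ dist x z + dist z q + dist q q' := dist_triangle4 _ _ _ _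
  have e4 := hyA.2
  rw [dist_comm A B] at hyy
  rw [dist_comm x z] at e3
  have := hmA q' hq' (by linarith)
  have := dist_triangle q q' y
  linarith

/-- Density step: make the trajectory from `x₀` strictly unique. -/
lemma aux_density {X : Type*} [NormedAddCommGroup X] [NormedSpace ℝ X]
    (C : Set X) (hCbd : Bornology.IsBounded C) (hCcv : Convex ℝ C)
    (x₀ : C) (F : MSet C) (ε : ℝ) (hε : 0 < ε) (k : ℕ) :
    ∃ (G : MSet C) (c : ℝ) (x : ℕ → C), 0 ≤ c ∧ c < 1 ∧
      (∀ u v : C, dist (G.1 u) (G.1 v) ≤ c * dist (u : X) (v : X)) ∧ dist F G < ε ∧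
      x 0 = x₀ ∧ ∀ j < k, projSet (G.1 (x j) : Set X) (x j) = {(x (j + 1) : X)} := by
  obtain ⟨D, hD, hDC⟩ : ∃ D > 0, ∀ p ∈ C, ∀ q ∈ C, dist p q ≤ D :=
    ⟨diam C + 1, by linarith [diam_nonneg (s := C)], fun p hp q hq => by
      linarith [dist_le_diam_of_mem hCbd hp hq]⟩
  have hcomb : ∀ p ∈ C, ∀ q ∈ C, ∀ t : ℝ, 0 ≤ t → t ≤ 1 → p + t • (q - p) ∈ C :=
    fun p hp q hq t h0 h1 => hCcv.add_smul_sub_mem hp hq ⟨h0, h1⟩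
  have hmove : ∀ p ∈ C, ∀ q ∈ C, ∀ t s : ℝ, 0 ≤ t → t ≤ s →
      dist p (p + t • (q - p)) ≤ s * D := by
    intro p hp q hq t s h0 h1
    rw [dist_self_add_right, norm_smul, Real.norm_of_nonneg h0, ← dist_eq_norm]
    exact mul_le_mul h1 (hDC _ hq _ hp) dist_nonneg (h0.trans h1)
  have hid : ∀ (p p' x : X) (h h' : ℝ), h ≤ 1 →
      dist (p + h • (x - p)) (p' + h' • (x - p')) ≤
        (1 - h) * dist p p' + |h - h'| * dist x p' := by
    intro p p' x h h' h1
    have : (p + h • (x - p)) - (p' + h' • (x - p')) =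
      (1 - h) • (p - p') + (h - h') • (x - p') := by module
    rw [dist_eq_norm, this, dist_eq_norm, dist_eq_norm]
    refine (norm_add_le _ _).trans ?_
    rw [norm_smul, norm_smul, Real.norm_of_nonneg (by linarith : 0 ≤ 1 - h), Real.norm_eq_abs]
  induction k with
  | zero =>
    obtain ⟨l, hl0, hl1, hlD⟩ : ∃ l > 0, l ≤ 1 ∧ l * D < ε := by
      refine ⟨min 1 (ε / (2 * D)), lt_min one_pos (by positivity), min_le_left _ _, ?_⟩
      calc _ ≤ ε / (2 * D) * D := by gcongr; exact min_le_right _ _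
        _ = ε / 2 := by field_simp
        _ < ε := by linarith
    obtain ⟨G, hG1, hG2, hG3⟩ := aux_pert C hCbd F 1 (by simpa using F.2.2)
      (fun _ p => p + l • ((x₀ : X) - p)) (by intro z; fun_prop)
      (fun z p hp => hcomb p hp _ x₀.2 l hl0.le hl1) (1 - l) 0 (by linarith)
      (by
        intro z z' p hp p' hp'
        have := hid p p' x₀ l l hl1
        simpa using this)
      (by linarith) (l * D) (by positivity)
      (fun z p hp => hmove p hp _ x₀.2 l l hl0.le le_rfl)
    exact ⟨G, (1 - l) * 1 + 0, fun _ => x₀, by linarith, by linarith, hG2, by linarith, rfl,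
      by simp⟩
  | succ k ih =>
    obtain ⟨F', c, x, hc0, hc1, hlip, hdist, hx0, hx⟩ := ih
    obtain ⟨y, hyF, hyd⟩ := (F'.1 (x k)).isCompact.exists_infDist_eq_dist
      (F'.1 (x k)).nonempty (x k : X)
    have hyC : y ∈ C := F'.2.1 _ hyF
    by_cases hd : (x k : X) = y
    · refine ⟨F', c, Function.update x (k + 1) ⟨y, hyC⟩, hc0, hc1, hlip, hdist, ?_, ?_⟩
      · rw [Function.update_of_ne (by omega)]; exact hx0
      · intro j hj
        rw [Function.update_of_ne (by omega)]
        rcases Nat.lt_succ_iff_lt_or_eq.1 hj with hj | rfl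
        · rw [Function.update_of_ne (by omega)]; exact hx j hj
        · rw [Function.update_self]
          apply aux_proj _ _ _ hyF
          intro q hq hne
          rw [hd, dist_self]
          exact dist_pos.2 hne.symm
    have hdpos : 0 < dist (x k : X) y := dist_pos.2 hd
    -- distinctness
    have hstep : ∀ j < k, infDist (x (j + 1) : X) (F'.1 (x (j + 1)) : Set X) ≤
        c * infDist (x j : X) (F'.1 (x j) : Set X) := by
      intro j hj
      have hm : (x (j + 1) : X) ∈ projSet (F'.1 (x j) : Set X) (x j) := by rw [hx j hj]; rfl
      obtain ⟨q, hq, hqd⟩ := aux_near _ (F'.1 (x (j + 1))) _ hm.1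
      rw [← hm.2]
      exact (infDist_le_dist_of_mem hq).trans (hqd.trans (hlip _ _))
    have hmono : ∀ m j, j + 1 + m ≤ k →
        infDist (x (j + 1 + m) : X) (F'.1 (x (j + 1 + m)) : Set X) ≤
        c * infDist (x j : X) (F'.1 (x j) : Set X) := by
      intro m j
      induction m with
      | zero => intro h; exact hstep j (by omega)
      | succ m ihm =>
        intro h
        have h1 := ihm (by omega)
        have h2 := hstep (j + 1 + m) (by omega)
        have h3 := infDist_nonneg (x := (x (j + 1 + m) : X))
          (s := (F'.1 (x (j + 1 + m)) : Set X))
        rw [← add_assoc]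
        nlinarith
    have hne : ∀ j < k, 0 < dist (x j : X) (x k) := by
      intro j hj
      rw [dist_pos]
      intro e
      have e' : x j = x k := Subtype.ext e
      have h1 := hmono (k - (j + 1)) j (by omega)
      rw [show j + 1 + (k - (j + 1)) = k by omega, e', hyd] at h1
      nlinarith
    obtain ⟨r, hr, hrk⟩ : ∃ r > 0, ∀ j < k, r ≤ dist (x j : X) (x k) := by
      rcases (Finset.range k).eq_empty_or_nonempty with he | hn
      · refine ⟨1, one_pos, fun j hj => ?_⟩
        have := Finset.mem_range.2 hj
        rw [he] at this; simp at this
      · obtain ⟨i, hi, hmin⟩ := Finset.exists_min_image _ (fun j => dist (x j : X) (x k)) hn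
        exact ⟨_, hne i (Finset.mem_range.1 hi), fun j hj => hmin j (Finset.mem_range.2 hj)⟩
    obtain ⟨η, hη, hηD⟩ : ∃ η > 0, η * D = (1 - c) / 4 :=
      ⟨(1 - c) / 4 / D, div_pos (by linarith) hD, by field_simp⟩
    obtain ⟨t, ht0, ht1, htr, htD⟩ : ∃ t > 0, t < 1 ∧ t ≤ η * r ∧ t * D < ε - dist F F' := by
      have hpos : 0 < ε - dist F F' := by linarith
      refine ⟨min (1 / 2) (min (η * r) ((ε - dist F F') / (2 * D))), ?_, ?_, ?_, ?_⟩
      · exact lt_min (by norm_num) (lt_min (by positivity) (by positivity))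
      · exact (min_le_left _ _).trans_lt (by norm_num)
      · exact (min_le_right _ _).trans (min_le_left _ _)
      · calc _ ≤ (ε - dist F F') / (2 * D) * D := by
              gcongr; exact (min_le_right _ _).trans (min_le_right _ _)
          _ = (ε - dist F F') / 2 := by field_simp
          _ < _ := by linarith
    let h : C → X → ℝ := fun z p => max 0 (t - η * dist p y - η * dist (z : X) (x k))
    have hh0 : ∀ z p, 0 ≤ h z p := fun z p => le_max_left _ _
    have hht : ∀ z p, h z p ≤ t := fun z p => max_le ht0.le (by
      have : 0 ≤ η * dist p y := by positivity
      have : 0 ≤ η * dist (z : X) (x k) := by positivity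
      linarith)
    have hhl : ∀ z z' p p', |h z p - h z' p'| ≤ η * dist p p' + η * dist (z : X) z' := by
      intro z z' p p'
      simp only [h]
      rw [max_comm 0 (t - η * dist p y - _), max_comm 0 (t - η * dist p' y - _)]
      refine (abs_max_sub_max_le_abs _ _ _).trans ?_
      have a1 := abs_dist_sub_le p p' y
      have a2 := abs_dist_sub_le (z : X) z' (x k)
      rw [abs_le] at *
      constructor <;> nlinarith
    obtain ⟨G, hG1, hG2, hG3⟩ := aux_pert C hCbd F' c hlip
      (fun z p => p + h z p • ((x k : X) - p)) (by intro z; simp only [h]; fun_prop)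
      (fun z p hp => hcomb p hp _ (x k).2 _ (hh0 _ _) ((hht _ _).trans ht1.le))
      (1 + η * D) (η * D) (by positivity)
      (by
        intro z z' p hp p' hp'
        refine (hid p p' (x k) _ _ ((hht z p).trans ht1.le)).trans ?_
        have a1 : |h z p - h z' p'| * dist (x k : X) p' ≤
            (η * dist p p' + η * dist (z : X) z') * D :=
          mul_le_mul (hhl _ _ _ _) (hDC _ (x k).2 _ hp') dist_nonneg (by positivity)
        have a2 : 0 ≤ h z p * dist p p' := mul_nonneg (hh0 _ _) dist_nonneg
        nlinarith)
      (by rw [hηD]; nlinarith) (t * D) (by positivity)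
      (fun z p hp => hmove p hp _ (x k).2 _ t (hh0 _ _) (hht _ _))
    have hy' : y + t • ((x k : X) - y) ∈ C := hcomb y hyC _ (x k).2 t ht0.le ht1.le
    have hhy : h (x k) y = t := by simp [h, ht0.le]
    refine ⟨G, (1 + η * D) * c + η * D, Function.update x (k + 1) ⟨_, hy'⟩, by positivity,
      by rw [hηD]; nlinarith, hG2, ?_, ?_, ?_⟩
    · have := dist_triangle F F' G
      linarith
    · rw [Function.update_of_ne (by omega)]; exact hx0
    · intro j hj
      rw [Function.update_of_ne (by omega)]
      rcases Nat.lt_succ_iff_lt_or_eq.1 hj with hj | rfl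
      · rw [Function.update_of_ne (by omega), hG1]
        have hz : ∀ p, h (x j) p = 0 := by
          intro p
          refine max_eq_left ?_
          have a1 := mul_le_mul_of_nonneg_left (hrk j hj) hη.le
          have : 0 ≤ η * dist p y := by positivity
          linarith
        simp only [hz, zero_smul, add_zero, image_id']
        exact hx j hj
      · rw [Function.update_self, hG1]
        have hdd : ∀ p, dist (x j : X) (p + h (x j) p • ((x j : X) - p)) =
            (1 - h (x j) p) * dist (x j : X) p := by
          intro p
          have : (x j : X) - (p + h (x j) p • ((x j : X) - p)) =
            (1 - h (x j) p) • ((x j : X) - p) := by module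
          rw [dist_eq_norm, this, norm_smul, Real.norm_of_nonneg (by linarith [hht (x j) p]),
            dist_eq_norm]
        apply aux_proj
        · exact ⟨y, hyF, by simp only [hhy]⟩
        · rintro _ ⟨p, hp, rfl⟩ hpne
          have e1 := hdd y
          rw [hhy] at e1
          simp only
          rw [e1, hdd p]
          have hpy : p ≠ y := by
            rintro rfl
            apply hpne
            simp only [hhy]
          have hlt : h (x j) p < t := by
            refine max_lt ht0 ?_
            have : 0 < η * dist p y := mul_pos hη (dist_pos.2 hpy)
            simp only [dist_self]
            linarith
          have hle : dist (x j : X) y ≤ dist (x j : X) p := by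
            rw [← hyd]; exact infDist_le_dist_of_mem hp
          nlinarith

lemma aux_stab {X : Type*} [NormedAddCommGroup X]
    (C : Set X) (G : MSet C) (x : ℕ → C) (n : ℕ)
    (hx : ∀ j < n, projSet (G.1 (x j) : Set X) (x j) = {(x (j + 1) : X)}) :
    ∀ k ≤ n, ∀ ε > 0, ∃ δ > 0, ∀ G' : MSet C, dist G' G < δ → ∀ v : ℕ → C,
      dist (v 0 : X) (x 0) < δ →
      (∀ j < k, (v (j + 1) : X) ∈ projSet (G'.1 (v j) : Set X) (v j)) →
      dist (v k : X) (x k) < ε := by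
  intro k
  induction k with
  | zero => intro _ ε hε; exact ⟨ε, hε, fun _ _ _ h _ => h⟩
  | succ k ih =>
    intro hk ε hε
    obtain ⟨δ1, hδ1, h1⟩ := aux_robust _ _ _ (hx k (by omega)) ε hε
    obtain ⟨δ2, hδ2, h2⟩ := ih (by omega) (δ1 / 2) (by linarith)
    refine ⟨min δ2 (δ1 / 2), lt_min hδ2 (by linarith), fun G' hG' v hv hs => ?_⟩
    have a := h2 G' (hG'.trans_le (min_le_left _ _)) v (hv.trans_le (min_le_left _ _))
      (fun j hj => hs j (by omega))
    refine h1 (v k) (G'.1 (v k)) (by linarith) ?_ _ (hs k (by omega))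
    have b1 : dist (G'.1 (v k)) (G.1 (v k)) ≤ dist G' G :=
      BoundedContinuousFunction.dist_coe_le_dist _
    have b2 := G.2.2 (v k) (x k)
    have b3 := dist_triangle (G'.1 (v k)) (G.1 (v k)) (G.1 (x k))
    have b4 := hG'.trans_le (min_le_right _ _)
    linarith

/-- Fix `x₀ ∈ C`, `n ∈ ℕ` and `β > 0`, and let
`𝓐_n(x₀) = {F ∈ 𝓜 : ∃ R > 0, every trajectory v₀,…,v_n w.r.t. F with v₀ ∈ B(x₀,R)`
`satisfies diam(P_{F(v_k)}(v_k)) ≤ β for all 0 ≤ k ≤ n}`. Then `𝓜 \ 𝓐_n(x₀)` is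
nowhere dense in `(𝓜, ρ)`. -/
theorem complement_An_nowhereDense
    {X : Type*} [NormedAddCommGroup X] [NormedSpace ℝ X] [CompleteSpace X]
    (C : Set X) (hCne : C.Nonempty) (hCcl : IsClosed C)
    (hCbd : Bornology.IsBounded C) (hCcv : Convex ℝ C)
    (x₀ : X) (hx₀ : x₀ ∈ C) (n : ℕ) (β : ℝ) (hβ : 0 < β) :
    IsNowhereDense {F : ↥(MSet C) | ¬ ∃ R > (0 : ℝ), ∀ v : ℕ → C,
        (v 0 : X) ∈ ball x₀ R →
        (∀ k < n, (v (k + 1) : X) ∈ projSet (F.1 (v k) : Set X) (v k)) →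
        ∀ k ≤ n, diam (projSet (F.1 (v k) : Set X) (v k)) ≤ β} := by
  rw [IsNowhereDense, eq_empty_iff_forall_notMem]
  intro F hF
  rw [mem_interior_iff_mem_nhds, Metric.mem_nhds_iff] at hF
  obtain ⟨ε, hε, hball⟩ := hF
  obtain ⟨G, c, x, -, -, -, hFG, hx0, hx⟩ :=
    aux_density C hCbd hCcv ⟨x₀, hx₀⟩ F ε hε (n + 1)
  have hG := hball (show G ∈ ball F ε by rw [mem_ball, dist_comm]; exact hFG)
  have hst := aux_stab C G x (n + 1) hx
  have hδ : ∀ k : ℕ, ∃ δ > 0, k ≤ n + 1 → ∀ G' : MSet C, dist G' G < δ → ∀ v : ℕ → C,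
      dist (v 0 : X) (x 0) < δ →
      (∀ j < k, (v (j + 1) : X) ∈ projSet (G'.1 (v j) : Set X) (v j)) →
      dist (v k : X) (x k) < β / 2 := by
    intro k
    by_cases hk : k ≤ n + 1
    · obtain ⟨δ, h1, h2⟩ := hst k hk (β / 2) (by linarith)
      exact ⟨δ, h1, fun _ => h2⟩
    · exact ⟨1, one_pos, fun h => absurd h hk⟩
  choose δ hδ0 hδ1 using hδ
  obtain ⟨i, -, hmin⟩ := Finset.exists_min_image (Finset.range (n + 2)) δ ⟨0, by simp⟩
  rw [Metric.mem_closure_iff] at hG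
  obtain ⟨G', hG', hd⟩ := hG (δ i) (hδ0 i)
  rw [dist_comm] at hd
  refine hG' ⟨δ i, hδ0 i, fun v hv hs k hk => ?_⟩
  have key : ∀ q ∈ projSet (G'.1 (v k) : Set X) (v k), dist q (x (k + 1) : X) < β / 2 := by
    intro q hq
    have hi := hmin (k + 1) (by simp; omega)
    have := hδ1 (k + 1) (by omega) G' (hd.trans_le hi)
      (Function.update v (k + 1) ⟨q, G'.2.1 _ hq.1⟩)
      (by
        rw [Function.update_of_ne (by omega), hx0]
        exact (mem_ball.1 hv).trans_le hi)
      (by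
        intro j hj
        rw [Function.update_of_ne (a := j) (by omega)]
        rcases Nat.lt_succ_iff_lt_or_eq.1 hj with hj | rfl
        · rw [Function.update_of_ne (by omega)]; exact hs j (by omega)
        · rw [Function.update_self]; exact hq)
    rwa [Function.update_self] at this
  refine diam_le_of_forall_dist_le hβ.le fun p hp q hq => ?_
  have h1 := key p hp
  have h2 := key q hq
  have h3 := dist_triangle_right p q (x (k + 1) : X)
  linarith
end

section
/- For every x₀ ∈ C, the set of all F ∈ 𝓜 which admit a regular trajectory starting at x₀ — i.e. for which there exists a sequence (x_k)_{k≥0} in C with x_0 = x₀ such that P_{F(x_k)}(x_k) is a singleton equal to {x_{k+1}} for every k ≥ 0 — is residual in the metric space (𝓜, ρ). -/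
open Metric Set TopologicalSpace BoundedContinuousFunction

section helpers

variable {X : Type*} [NormedAddCommGroup X]

/-- Points reached after `k` steps. -/
def RS (C : Set X) (x₀ : X) (F : C →ᵇ TopologicalSpace.NonemptyCompacts X) : ℕ → Set C
  | 0 => {p | (p : X) = x₀}
  | k + 1 => {q | ∃ p ∈ RS C x₀ F k, (q : X) ∈ projSet (F p : Set X) p}

lemma proj_nonempty (K : NonemptyCompacts X) (x : X) : ∃ y, y ∈ projSet (K : Set X) x := by
  obtain ⟨y, hy, h⟩ := K.isCompact.exists_infDist_eq_dist K.nonempty x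
  exact ⟨y, hy, h.symm⟩

lemma RS_nonempty {C : Set X} {x₀ : X} (hx₀ : x₀ ∈ C)
    {F : C →ᵇ TopologicalSpace.NonemptyCompacts X} (hF : F ∈ MSet C) (k : ℕ) :
    (RS C x₀ F k).Nonempty := by
  induction k with
  | zero => exact ⟨⟨x₀, hx₀⟩, rfl⟩
  | succ k ih =>
    obtain ⟨p, hp⟩ := ih
    obtain ⟨y, hy⟩ := proj_nonempty (F p) (p : X)
    exact ⟨⟨y, hF.1 p hy.1⟩, p, hp, hy⟩

lemma exists_close (K L : NonemptyCompacts X) {z : X} (hz : z ∈ K) :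
    ∃ w ∈ L, dist z w ≤ dist K L := by
  obtain ⟨y, hy, h⟩ := L.isCompact.exists_infDist_eq_dist L.nonempty z
  refine ⟨y, hy, ?_⟩
  rw [← h, NonemptyCompacts.dist_eq]
  exact Metric.infDist_le_hausdorffDist_of_mem hz
    (Metric.hausdorffEDist_ne_top_of_nonempty_of_bounded K.nonempty L.nonempty
      K.isCompact.isBounded L.isCompact.isBounded)

lemma proj_stable (K : NonemptyCompacts X) (x p : X)
    (h : ∀ q ∈ projSet (K : Set X) x, q = p) {ε : ℝ} (hε : 0 < ε) :
    ∃ δ > 0, ∀ (K' : NonemptyCompacts X) (x' : X), dist x' x < δ → dist K' K < δ →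
      ∀ q ∈ projSet (K' : Set X) x', dist q p < ε := by
  have key : ∃ γ > 0, ∀ z ∈ K, dist x z < Metric.infDist x (K : Set X) + γ →
      dist z p < ε / 2 := by
    by_cases hne : ((K : Set X) \ Metric.ball p (ε/2)).Nonempty
    · have hc : IsCompact ((K : Set X) \ Metric.ball p (ε/2)) :=
        K.isCompact.diff Metric.isOpen_ball
      obtain ⟨w, hw, hmin⟩ := hc.exists_isMinOn hne
        (f := fun z => dist x z) (by fun_prop)
      have hlt : Metric.infDist x (K : Set X) < dist x w := by
        refine lt_of_le_of_ne (Metric.infDist_le_dist_of_mem hw.1) ?_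
        intro he
        have := h w ⟨hw.1, he.symm⟩
        apply hw.2
        rw [this]
        exact Metric.mem_ball_self (by linarith)
      refine ⟨dist x w - Metric.infDist x (K : Set X), by linarith, ?_⟩
      intro z hz hlt'
      by_contra hcon
      have : dist x w ≤ dist x z := hmin (⟨hz, fun hb => hcon hb⟩ : z ∈ (K : Set X) \ Metric.ball p (ε/2))
      linarith
    · refine ⟨1, one_pos, ?_⟩
      intro z hz _
      by_contra hcon
      exact hne ⟨z, hz, fun hb => hcon hb⟩
  obtain ⟨γ, hγ, hk⟩ := key
  refine ⟨min (ε/2) (γ/4), by positivity, ?_⟩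
  intro K' x' hx hK q hq
  have h1 := lt_of_lt_of_le hx (min_le_left _ _)
  have h2 := lt_of_lt_of_le hx (min_le_right _ _)
  have h3 := lt_of_lt_of_le hK (min_le_left _ _)
  have h4 := lt_of_lt_of_le hK (min_le_right _ _)
  obtain ⟨z, hz, hqz⟩ := exists_close K' K hq.1
  obtain ⟨y, hy, hyd⟩ := K.isCompact.exists_infDist_eq_dist K.nonempty x
  obtain ⟨y', hy', hyy⟩ := exists_close K K' hy
  have h5 : dist x' q ≤ dist x' y' := by
    rw [hq.2]; exact Metric.infDist_le_dist_of_mem hy'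
  rw [dist_comm K K'] at hyy
  have t1 := dist_triangle4 x x' q z
  have t2 := dist_triangle4 x' x y y'
  rw [dist_comm x x'] at t1
  have := hk z hz (by linarith)
  have := dist_triangle q z p
  linarith

lemma RS_stable {C : Set X} {x₀ : X} (hx₀ : x₀ ∈ C)
    {F : C →ᵇ TopologicalSpace.NonemptyCompacts X} (hF : F ∈ MSet C) (n : ℕ)
    (hs : ∀ k ≤ n, (RS C x₀ F k).Subsingleton) (p : C) (hp : p ∈ RS C x₀ F n) :
    ∀ ε > 0, ∃ δ > 0, ∀ G : C →ᵇ TopologicalSpace.NonemptyCompacts X, dist G F < δ →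
      ∀ q ∈ RS C x₀ G n, dist q p < ε := by
  induction n generalizing p with
  | zero =>
    intro ε hε
    refine ⟨1, one_pos, fun G _ q hq => ?_⟩
    have : q = p := Subtype.ext ((show (q : X) = x₀ from hq).trans (show (p : X) = x₀ from hp).symm)
    rw [this, dist_self]; exact hε
  | succ n ih =>
    intro ε hε
    obtain ⟨a, ha, hpa⟩ := id hp
    obtain ⟨δ, hδ, hst⟩ := proj_stable (F a) (a : X) (p : X) (by
      intro q hq
      have : (⟨q, hF.1 a hq.1⟩ : C) = p := hs (n+1) le_rfl ⟨a, ha, hq⟩ hp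
      exact congrArg Subtype.val this) hε
    obtain ⟨δ', hδ', h'⟩ := ih (fun k hk => hs k (by omega)) a ha (δ/2) (by positivity)
    refine ⟨min δ' (δ/2), by positivity, ?_⟩
    intro G hG q hq
    obtain ⟨b, hb, hqb⟩ := hq
    have h1 := h' G (lt_of_lt_of_le hG (min_le_left _ _)) b hb
    have h2 := lt_of_lt_of_le hG (min_le_right _ _)
    refine hst (G b) b ?_ ?_ q hqb
    · have : dist (b : X) a = dist b a := rfl
      linarith
    · have e1 := BoundedContinuousFunction.dist_coe_le_dist (f := G) (g := F) b
      have e2 := hF.2 b a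
      have : dist (b : X) a = dist b a := rfl
      have := dist_triangle (G b) (F b) (F a)
      linarith

lemma exists_map {C : Set X} (hCbd : Bornology.IsBounded C)
    {F : C →ᵇ TopologicalSpace.NonemptyCompacts X} (hF : F ∈ MSet C) {c : ℝ}
    (hc : ∀ x y : C, dist (F x) (F y) ≤ c * dist (x : X) (y : X))
    (T : C → X → X) (hT : ∀ x, Continuous (T x)) (hTC : ∀ x, ∀ z ∈ C, T x z ∈ C)
    {a b ε : ℝ} (ha : 0 ≤ a) (h1 : a * c + b ≤ 1) (hε : 0 ≤ ε)
    (hL : ∀ x x' : C, ∀ z ∈ C, ∀ z' ∈ C,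
      dist (T x z) (T x' z') ≤ a * dist z z' + b * dist (x : X) x')
    (hcl : ∀ x, ∀ z ∈ C, dist (T x z) z ≤ ε) :
    ∃ G ∈ MSet C, (∀ x, (G x : Set X) = T x '' (F x : Set X)) ∧
      (∀ x y : C, dist (G x) (G y) ≤ (a * c + b) * dist (x : X) (y : X)) ∧ dist G F ≤ ε := by
  let g : C → NonemptyCompacts X := fun x =>
    ⟨⟨T x '' (F x : Set X), (F x).isCompact.image (hT x)⟩, (F x).nonempty.image _⟩
  have hg : ∀ x, (g x : Set X) = T x '' (F x : Set X) := fun x => rfl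
  have aux : ∀ x y : C, ∀ z ∈ F x, ∃ w ∈ T y '' (F y : Set X),
      dist (T x z) w ≤ (a * c + b) * dist (x : X) (y : X) := by
    intro x y z hz
    obtain ⟨w, hw, hzw⟩ := exists_close (F x) (F y) hz
    refine ⟨T y w, mem_image_of_mem _ hw, ?_⟩
    have e1 := hL x y z (hF.1 x hz) w (hF.1 y hw)
    have e2 := mul_le_mul_of_nonneg_left (hzw.trans (hc x y)) ha
    linarith
  have hlip : ∀ x y : C, dist (g x) (g y) ≤ (a * c + b) * dist (x : X) (y : X) := by
    intro x y
    by_cases hxy : x = y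
    · subst hxy; simp
    have hpos : 0 < dist (x : X) (y : X) := dist_pos.2 (fun h => hxy (Subtype.ext h))
    rw [NonemptyCompacts.dist_eq, hg, hg]
    have hnn : 0 ≤ (a * c + b) * dist (x : X) (y : X) := by
      obtain ⟨z, hz⟩ := (F x).nonempty
      obtain ⟨w, _, hw⟩ := aux x y z hz
      exact dist_nonneg.trans hw
    apply Metric.hausdorffDist_le_of_mem_dist hnn
    · rintro _ ⟨z, hz, rfl⟩
      exact aux x y z hz
    · rintro _ ⟨z, hz, rfl⟩
      rw [dist_comm (x : X)]
      exact aux y x z hz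
  have hlip1 : ∀ x y : C, dist (g x) (g y) ≤ dist (x : X) (y : X) := fun x y =>
    (hlip x y).trans (by nlinarith [dist_nonneg (x := (x : X)) (y := (y : X))])
  have hcont : Continuous g := by
    have : LipschitzWith 1 g := LipschitzWith.of_dist_le_mul (fun x y => by
      rw [NNReal.coe_one, one_mul]; exact hlip1 x y)
    exact this.continuous
  let G : C →ᵇ NonemptyCompacts X := BoundedContinuousFunction.mkOfBound ⟨g, hcont⟩ (Metric.diam C)
    (fun x y => (hlip1 x y).trans (Metric.dist_le_diam_of_mem hCbd x.2 y.2))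
  refine ⟨G, ⟨?_, hlip1⟩, hg, hlip, ?_⟩
  · rintro x _ ⟨z, hz, rfl⟩
    exact hTC x z (hF.1 x hz)
  · rw [BoundedContinuousFunction.dist_le hε]
    intro x
    change dist (g x) (F x) ≤ ε
    rw [NonemptyCompacts.dist_eq, hg]
    apply Metric.hausdorffDist_le_of_mem_dist hε
    · rintro _ ⟨z, hz, rfl⟩
      exact ⟨z, hz, hcl x z (hF.1 x hz)⟩
    · intro z hz
      exact ⟨T x z, mem_image_of_mem _ hz, by rw [dist_comm]; exact hcl x z (hF.1 x hz)⟩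

variable [NormedSpace ℝ X]

/-- Move `z` towards `v`. -/
def mv (v z : X) (s : ℝ) : X := z + s • (v - z)

lemma mv_mem {C : Set X} (hC : Convex ℝ C) {v z : X} (hv : v ∈ C) (hz : z ∈ C) {s : ℝ}
    (h0 : 0 ≤ s) (h1 : s ≤ 1) : mv v z s ∈ C :=
  hC.add_smul_sub_mem hz hv ⟨h0, h1⟩

lemma mv_dist (v z : X) {s : ℝ} (h0 : 0 ≤ s) : dist (mv v z s) z = s * dist v z := by
  rw [mv, dist_eq_norm, add_sub_cancel_left, norm_smul, Real.norm_of_nonneg h0, dist_eq_norm]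

lemma mv_dist' (v z : X) {s : ℝ} (h1 : s ≤ 1) : dist v (mv v z s) = (1 - s) * dist v z := by
  have : v - mv v z s = (1 - s) • (v - z) := by rw [mv]; module
  rw [dist_eq_norm, this, norm_smul, Real.norm_of_nonneg (by linarith), dist_eq_norm]

lemma mv_lip (v z z' : X) {s s' : ℝ} (h1 : s ≤ 1) :
    dist (mv v z s) (mv v z' s') ≤ (1 - s) * dist z z' + |s - s'| * dist v z' := by
  have : mv v z s - mv v z' s' = (1 - s) • (z - z') + (s - s') • (v - z') := by
    rw [mv, mv]; module
  rw [dist_eq_norm, this]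
  refine (norm_add_le _ _).trans ?_
  rw [norm_smul, norm_smul, Real.norm_of_nonneg (by linarith : 0 ≤ 1 - s), dist_eq_norm,
    dist_eq_norm, Real.norm_eq_abs]

lemma dense_zero {C : Set X} (hCbd : Bornology.IsBounded C) (hCcv : Convex ℝ C)
    {x₀ : X} (hx₀ : x₀ ∈ C) {D : ℝ} (hD : 0 < D) (hDb : ∀ x ∈ C, ∀ y ∈ C, dist x y ≤ D)
    {F : C →ᵇ TopologicalSpace.NonemptyCompacts X} (hF : F ∈ MSet C) {ε : ℝ} (hε : 0 < ε) :
    ∃ G ∈ MSet C, dist G F ≤ ε ∧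
      ∃ c, 0 ≤ c ∧ c < 1 ∧ ∀ x y : C, dist (G x) (G y) ≤ c * dist (x : X) (y : X) := by
  set t := min (1/2) (ε / D) with ht
  have t0 : 0 < t := by positivity
  have t1 : t ≤ 1/2 := min_le_left _ _
  have t2 : t * D ≤ ε := by
    rw [← le_div_iff₀ hD]; exact min_le_right _ _
  obtain ⟨G, hG, -, hl, hd⟩ := exists_map hCbd hF (c := 1) (by simpa using hF.2)
    (fun _ z => mv x₀ z t) (fun x => by unfold mv; fun_prop)
    (fun _ z hz => mv_mem hCcv hx₀ hz t0.le (by linarith)) (a := 1 - t) (b := 0) (ε := ε)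
    (by linarith) (by linarith) hε.le
    (fun x x' z hz z' hz' => by
      have := mv_lip x₀ z z' (s := t) (s' := t) (by linarith)
      simpa using this)
    (fun _ z hz => by
      rw [mv_dist _ _ t0.le]
      exact (mul_le_mul_of_nonneg_left (hDb _ hx₀ _ hz) t0.le).trans t2)
  exact ⟨G, hG, hd, (1 - t) * 1 + 0, by linarith, by linarith, hl⟩

lemma dense_step {C : Set X} (hCbd : Bornology.IsBounded C) (hCcv : Convex ℝ C)
    {x₀ : X} (hx₀ : x₀ ∈ C) {D : ℝ} (hD : 0 < D) (hDb : ∀ x ∈ C, ∀ y ∈ C, dist x y ≤ D)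
    (n : ℕ) {F : C →ᵇ TopologicalSpace.NonemptyCompacts X} (hF : F ∈ MSet C)
    (hs : ∀ k ≤ n, (RS C x₀ F k).Subsingleton)
    {c : ℝ} (c0 : 0 ≤ c) (c1 : c < 1)
    (hc : ∀ x y : C, dist (F x) (F y) ≤ c * dist (x : X) (y : X)) {ε : ℝ} (hε : 0 < ε) :
    ∃ G ∈ MSet C, dist G F ≤ ε ∧ (∀ k ≤ n + 1, (RS C x₀ G k).Subsingleton) ∧
      ∃ c, 0 ≤ c ∧ c < 1 ∧ ∀ x y : C, dist (G x) (G y) ≤ c * dist (x : X) (y : X) := by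
  obtain ⟨p, hp⟩ := RS_nonempty hx₀ hF n
  by_cases hper : ∃ j < n, p ∈ RS C x₀ F j
  · obtain ⟨j, hj, hpj⟩ := hper
    refine ⟨F, hF, by simpa using hε.le, ?_, c, c0, c1, hc⟩
    intro k hk
    rcases Nat.lt_or_ge k (n+1) with h | h
    · exact hs k (by omega)
    obtain rfl : k = n + 1 := by omega
    have key : ∀ q ∈ RS C x₀ F (n+1), q ∈ RS C x₀ F (j+1) := by
      rintro q ⟨a, ha, hq⟩
      have : a = p := hs n le_rfl ha hp
      subst this
      exact ⟨a, hpj, hq⟩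
    exact fun q hq q' hq' => hs (j+1) (by omega) (key q hq) (key q' hq')
  · have hfin : (⋃ j ∈ Set.Iio n, RS C x₀ F j).Finite :=
      (Set.finite_Iio n).biUnion (fun j hj => (hs j (le_of_lt hj)).finite)
    have hpn : p ∈ (⋃ j ∈ Set.Iio n, RS C x₀ F j)ᶜ := by
      intro h
      simp only [mem_iUnion] at h
      obtain ⟨j, hj, h⟩ := h
      exact hper ⟨j, hj, h⟩
    obtain ⟨r, hr, hball⟩ := Metric.isOpen_iff.1 hfin.isClosed.isOpen_compl p hpn
    have hfar : ∀ j < n, ∀ q ∈ RS C x₀ F j, r ≤ dist (q : X) p := by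
      intro j hj q hq
      by_contra hcon
      refine hball (show q ∈ Metric.ball p r from not_le.1 hcon) ?_
      simp only [mem_iUnion]
      exact ⟨j, hj, hq⟩
    obtain ⟨y, hy⟩ := proj_nonempty (F p) (p : X)
    have hyC : y ∈ C := hF.1 p hy.1
    set η := min (1/2) (min (ε / D) ((1 - c) * r / (4 * D))) with hη
    have c1' : 0 < 1 - c := by linarith
    have e0 : 0 < η := by positivity
    have e1 : η ≤ 1/2 := min_le_left _ _
    have e2 : η * D ≤ ε := by
      rw [← le_div_iff₀ hD]; exact (min_le_right _ _).trans (min_le_left _ _)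
    have e3 : η * D / r ≤ (1 - c) / 4 := by
      have : η ≤ (1 - c) * r / (4 * D) := (min_le_right _ _).trans (min_le_right _ _)
      rw [le_div_iff₀ (by positivity)] at this
      rw [div_le_iff₀ hr]
      linarith
    set κ := η * D / r with hκ
    have k0 : 0 < κ := by positivity
    let s : C → X → ℝ := fun x z => η * max 0 (1 - (dist (x : X) p + dist z y) / r)
    have s0 : ∀ x z, 0 ≤ s x z := fun x z => by positivity
    have s1 : ∀ x z, s x z ≤ η := fun x z => by
      have : max 0 (1 - (dist (x : X) p + dist z y) / r) ≤ 1 := by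
        apply max_le zero_le_one
        have : 0 ≤ (dist (x : X) p + dist z y) / r := by positivity
        linarith
      calc s x z ≤ η * 1 := mul_le_mul_of_nonneg_left this e0.le
        _ = η := mul_one _
    have sl : ∀ x x' z z', |s x z - s x' z'| ≤ η / r * (dist z z' + dist (x : X) x') := by
      intro x x' z z'
      have h1 : |max 0 (1 - (dist (x : X) p + dist z y) / r) -
          max 0 (1 - (dist (x' : X) p + dist z' y) / r)| ≤ (dist z z' + dist (x : X) x') / r := by
        refine (abs_max_sub_max_le_max _ _ _ _).trans ?_
        rw [sub_self, abs_zero]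
        apply max_le (by positivity)
        rw [show (1 - (dist (x : X) p + dist z y) / r) - (1 - (dist (x' : X) p + dist z' y) / r)
          = ((dist (x' : X) p - dist (x : X) p) + (dist z' y - dist z y)) / r by ring,
          abs_div, abs_of_pos hr]
        apply div_le_div_of_nonneg_right _ hr.le
        have a1 := abs_dist_sub_le (x' : X) x p
        have a2 := abs_dist_sub_le z' z y
        rw [dist_comm (x' : X) x] at a1
        rw [dist_comm z' z] at a2
        exact (abs_add_le _ _).trans (by linarith)
      have : s x z - s x' z' = η * (max 0 (1 - (dist (x : X) p + dist z y) / r) -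
          max 0 (1 - (dist (x' : X) p + dist z' y) / r)) := by ring
      rw [this, abs_mul, abs_of_pos e0]
      calc _ ≤ η * ((dist z z' + dist (x : X) x') / r) := mul_le_mul_of_nonneg_left h1 e0.le
        _ = _ := by ring
    obtain ⟨G, hG, hGe, hl, hd⟩ := exists_map hCbd hF hc
      (fun x z => mv (p : X) z (s x z)) (fun x => by unfold mv; fun_prop)
      (fun x z hz => mv_mem hCcv p.2 hz (s0 x z) ((s1 x z).trans (by linarith)))
      (a := 1 + κ) (b := κ) (ε := ε) (by linarith) (by nlinarith) hε.le
      (fun x x' z hz z' hz' => by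
        have h1 := mv_lip (p : X) z z' (s := s x z) (s' := s x' z') ((s1 x z).trans (by linarith))
        have h2 : (1 - s x z) * dist z z' ≤ 1 * dist z z' :=
          mul_le_mul_of_nonneg_right (by linarith [s0 x z]) dist_nonneg
        have h3 : |s x z - s x' z'| * dist (p : X) z' ≤
            η / r * (dist z z' + dist (x : X) x') * D :=
          mul_le_mul (sl x x' z z') (hDb _ p.2 _ hz') dist_nonneg (by positivity)
        have h4 : η / r * (dist z z' + dist (x : X) x') * D =
          κ * dist z z' + κ * dist (x : X) x' := by rw [hκ]; ring
        linarith)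
      (fun x z hz => by
        rw [mv_dist _ _ (s0 x z)]
        exact (mul_le_mul (s1 x z) (hDb _ p.2 _ hz) dist_nonneg e0.le).trans e2)
    have hsame : ∀ j < n, ∀ q ∈ RS C x₀ F j, (G q : Set X) = F q := by
      intro j hj q hq
      have hz : ∀ z, mv (p : X) z (s q z) = z := by
        intro z
        have : s q z = 0 := by
          have h1 : 1 ≤ (dist (q : X) p + dist z y) / r := by
            rw [le_div_iff₀ hr]
            linarith [hfar j hj q hq, dist_nonneg (x := z) (y := y)]
          change η * max 0 _ = 0
          rw [max_eq_left (by linarith), mul_zero]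
        simp [mv, this]
      rw [hGe]
      simp [hz]
    have hR : ∀ j ≤ n, RS C x₀ G j = RS C x₀ F j := by
      intro j
      induction j with
      | zero => intro _; rfl
      | succ j ih =>
        intro hj
        have ih := ih (by omega)
        ext q
        constructor
        · rintro ⟨a, ha, hq⟩
          rw [ih] at ha
          rw [hsame j (by omega) a ha] at hq
          exact ⟨a, ha, hq⟩
        · rintro ⟨a, ha, hq⟩
          refine ⟨a, ih ▸ ha, ?_⟩
          rw [hsame j (by omega) a ha]
          exact hq
    refine ⟨G, hG, hd, ?_, (1 + κ) * c + κ, by positivity, by nlinarith, hl⟩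
    intro k hk
    rcases Nat.lt_or_ge k (n+1) with h | h
    · rw [hR k (by omega)]; exact hs k (by omega)
    obtain rfl : k = n + 1 := by omega
    have sy : s p y = η := by simp [s]
    have key : ∀ q ∈ RS C x₀ G (n+1), (q : X) = mv (p : X) y η := by
      rintro q ⟨a, ha, hq⟩
      rw [hR n le_rfl] at ha
      have : a = p := hs n le_rfl ha hp
      subst this
      have hle : dist (a : X) q ≤ (1 - η) * dist (a : X) y := by
        rw [hq.2, ← mv_dist' _ _ (by linarith)]
        apply Metric.infDist_le_dist_of_mem
        rw [hGe]
        exact ⟨y, hy.1, by simp only [sy]⟩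
      have hq1 := hq.1
      rw [hGe] at hq1
      obtain ⟨z, hz, hzq⟩ := hq1
      simp only at hzq
      rcases eq_or_ne z y with rfl | hzy
      · rw [← hzq, sy]
      have hyz : dist (a : X) y ≤ dist (a : X) z := by
        rw [hy.2]; exact Metric.infDist_le_dist_of_mem hz
      rcases (dist_nonneg (x := (a : X)) (y := y)).eq_or_lt with h0 | h0
      · have h1 : (a : X) = y := dist_eq_zero.1 h0.symm
        rw [← h0, mul_zero] at hle
        have h2 : (a : X) = q := dist_le_zero.1 hle
        rw [← h2, mv, ← h1]; simp
      · exfalso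
        have hlt : s a z < η := by
          have hzp : 0 < dist z y := dist_pos.2 hzy
          have : max 0 (1 - (dist (a : X) a + dist z y) / r) < 1 := by
            apply max_lt zero_lt_one
            rw [dist_self, zero_add]
            have : 0 < dist z y / r := by positivity
            linarith
          calc s a z < η * 1 := mul_lt_mul_of_pos_left this e0
            _ = η := mul_one _
        rw [← hzq, mv_dist' _ _ (by linarith)] at hle
        have h3 : (1 - s a z) * dist (a : X) y ≤ (1 - s a z) * dist (a : X) z :=
          mul_le_mul_of_nonneg_left hyz (by linarith)
        have h4 : (1 - η) * dist (a : X) y < (1 - s a z) * dist (a : X) y :=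
          mul_lt_mul_of_pos_right (by linarith) h0
        linarith
    exact fun q hq q' hq' => Subtype.ext ((key q hq).trans (key q' hq').symm)

lemma dense_all {C : Set X} (hCbd : Bornology.IsBounded C) (hCcv : Convex ℝ C)
    {x₀ : X} (hx₀ : x₀ ∈ C) {D : ℝ} (hD : 0 < D) (hDb : ∀ x ∈ C, ∀ y ∈ C, dist x y ≤ D)
    (n : ℕ) {F : C →ᵇ TopologicalSpace.NonemptyCompacts X} (hF : F ∈ MSet C)
    {ε : ℝ} (hε : 0 < ε) :
    ∃ G ∈ MSet C, dist G F ≤ ε ∧ (∀ k ≤ n, (RS C x₀ G k).Subsingleton) ∧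
      ∃ c, 0 ≤ c ∧ c < 1 ∧ ∀ x y : C, dist (G x) (G y) ≤ c * dist (x : X) (y : X) := by
  induction n generalizing ε with
  | zero =>
    obtain ⟨G, hG, hd, hc⟩ := dense_zero hCbd hCcv hx₀ hD hDb hF hε
    refine ⟨G, hG, hd, ?_, hc⟩
    intro k hk
    obtain rfl : k = 0 := by omega
    exact fun p hp q hq => Subtype.ext
      ((show (p : X) = x₀ from hp).trans (show (q : X) = x₀ from hq).symm)
  | succ n ih =>
    obtain ⟨G, hG, hd, hs, c, c0, c1, hc⟩ := ih (half_pos hε)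
    obtain ⟨G', hG', hd', h'⟩ :=
      dense_step hCbd hCcv hx₀ hD hDb n hG hs c0 c1 hc (half_pos hε)
    refine ⟨G', hG', ?_, h'⟩
    have := dist_triangle G' G F
    linarith

end helpers

/-- For every `x₀ ∈ C`, the set of mappings `F ∈ 𝓜` admitting a
regular trajectory starting at `x₀` — a sequence `(x_k)` in `C` with `x_0 = x₀` and
`P_{F(x_k)}(x_k) = {x_{k+1}}` (a singleton) for all `k` — is residual in `(𝓜, ρ)`. -/
theorem regular_trajectory_residual
    {X : Type*} [NormedAddCommGroup X] [NormedSpace ℝ X] [CompleteSpace X]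
    (C : Set X) (hCne : C.Nonempty) (hCcl : IsClosed C)
    (hCbd : Bornology.IsBounded C) (hCcv : Convex ℝ C)
    (x₀ : X) (hx₀ : x₀ ∈ C) :
    {F : ↥(MSet C) | ∃ x : ℕ → C, (x 0 : X) = x₀ ∧
        ∀ k : ℕ, projSet (F.1 (x k) : Set X) (x k) = {(x (k + 1) : X)}} ∈
      residual ↥(MSet C) := by
  obtain ⟨D, hD, hDb⟩ : ∃ D : ℝ, 0 < D ∧ ∀ x ∈ C, ∀ y ∈ C, dist x y ≤ D :=
    ⟨Metric.diam C + 1, by linarith [Metric.diam_nonneg (s := C)], fun x hx y hy => by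
      linarith [Metric.dist_le_diam_of_mem hCbd hx hy]⟩
  let V : ℕ → ℕ → Set (MSet C) := fun n m =>
    interior {F | ∀ p ∈ RS C x₀ F.1 n, ∀ q ∈ RS C x₀ F.1 n, dist p q ≤ 1 / ((m : ℝ) + 1)}
  have hV : ∀ n m, V n m ∈ residual (MSet C) := by
    intro n m
    apply residual_of_dense_open isOpen_interior
    rw [Metric.dense_iff]
    intro F ε hε
    obtain ⟨G, hG, hd, hs, -⟩ := dense_all hCbd hCcv hx₀ hD hDb n F.2 (half_pos hε)
    refine ⟨⟨G, hG⟩, ?_, ?_⟩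
    · change dist G F.1 < ε
      linarith
    · obtain ⟨p, hp⟩ := RS_nonempty hx₀ hG n
      obtain ⟨δ, hδ, hst⟩ := RS_stable hx₀ hG n hs p hp (1 / ((m : ℝ) + 1) / 2) (by positivity)
      rw [mem_interior_iff_mem_nhds, Metric.mem_nhds_iff]
      refine ⟨δ, hδ, ?_⟩
      intro G' hG' a ha b hb
      have h1 := hst G'.1 hG' a ha
      have h2 := hst G'.1 hG' b hb
      have := dist_triangle_right a b p
      linarith
  have hall : (⋂ n, ⋂ m, V n m) ∈ residual (MSet C) :=
    countable_iInter_mem.2 fun n => countable_iInter_mem.2 fun m => hV n m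
  refine Filter.mem_of_superset hall ?_
  intro F hF
  have hsub : ∀ n, (RS C x₀ F.1 n).Subsingleton := by
    intro n p hp q hq
    have : ∀ m : ℕ, dist p q ≤ 1 / ((m : ℝ) + 1) := fun m =>
      interior_subset (mem_iInter.1 (mem_iInter.1 hF n) m) p hp q hq
    apply dist_le_zero.1
    exact ge_of_tendsto' tendsto_one_div_add_atTop_nhds_zero_nat this
  choose x hx using fun k => RS_nonempty hx₀ F.2 k
  refine ⟨x, hx 0, fun k => ?_⟩
  have hmem : ∀ q ∈ projSet (F.1 (x k) : Set X) (x k), q = x (k+1) := by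
    intro q hq
    have : (⟨q, F.2.1 (x k) hq.1⟩ : C) = x (k+1) := hsub (k+1) ⟨x k, hx k, hq⟩ (hx (k+1))
    exact congrArg Subtype.val this
  obtain ⟨y, hy⟩ := proj_nonempty (F.1 (x k)) (x k : X)
  ext q
  constructor
  · exact hmem q
  · intro hq
    rw [mem_singleton_iff] at hq
    rw [hq, ← hmem y hy]
    exact hy
end
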